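/- arXiv:math/0702444 — 5 statements merged into one kernel-verified Lean document; each statement's English description precedes it below -/
import Mathlib

section
/- Let K be a field, A a graded Artinian K-algebra, and V = ⊕_{i=a}^{b} V_i a finite graded A-module whose Hilbert function is unimodal, with V_a ≠ 0 and V_b ≠ 0. Then for a linear form ℓ ∈ A_1 the following are equivalent: (1) ℓ is a weak Lefschetz element of V; (2) dim_K V/ℓV = Sperner(V); (3) the rank of the multiplication map ×ℓ : V → V equals CoSperner(V). -/
set_option maxHeartbeats 1000000
set_option synthInstance.maxHeartbeats 400000

open TensorProduct

section LefschetzPrelude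

variable (K : Type) [Field K]

/-- `𝒜` makes `A` into a graded Artinian `K`-algebra (with possibly non-standard
grading): `A` is the internal direct sum of the `𝒜 i`, the grading is
multiplicative, `A₀ = K·1` and `A` is finite dimensional over `K`. -/
def IsGradedArtinAlg {A : Type} [CommRing A] [Algebra K A]
    (𝒜 : ℕ → Submodule K A) : Prop :=
  DirectSum.IsInternal 𝒜 ∧
  (1 : A) ∈ 𝒜 0 ∧
  (∀ i j : ℕ, ∀ x ∈ 𝒜 i, ∀ y ∈ 𝒜 j, x * y ∈ 𝒜 (i + j)) ∧
  𝒜 0 = Submodule.span K {(1 : A)} ∧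
  FiniteDimensional K A

/-- `c` is the top degree of the grading `𝒜`. -/
def GradedTop {A : Type} [CommRing A] [Algebra K A]
    (𝒜 : ℕ → Submodule K A) (c : ℕ) : Prop :=
  𝒜 c ≠ ⊥ ∧ ∀ i : ℕ, c < i → 𝒜 i = ⊥

/-- `ℳ` makes the `A`-module `V` into a finite graded module over the graded
algebra `(A, 𝒜)`. -/
def IsGradedMod {A V : Type} [CommRing A] [Algebra K A] [AddCommGroup V]
    [Module K V] [Module A V] [IsScalarTower K A V]
    (𝒜 : ℕ → Submodule K A) (ℳ : ℤ → Submodule K V) : Prop :=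
  DirectSum.IsInternal ℳ ∧
  (∀ (i : ℕ) (j : ℤ), ∀ a ∈ 𝒜 i, ∀ v ∈ ℳ j, a • v ∈ ℳ (j + i)) ∧
  FiniteDimensional K V

/-- The graded pieces of `ℳ` are supported exactly between degrees `a` and `b`. -/
def GradedBetween {V : Type} [AddCommGroup V] [Module K V]
    (ℳ : ℤ → Submodule K V) (a b : ℤ) : Prop :=
  a ≤ b ∧ ℳ a ≠ ⊥ ∧ ℳ b ≠ ⊥ ∧ ∀ i : ℤ, i < a ∨ b < i → ℳ i = ⊥

/-- Multiplication by `g : A` on the `A`-module `V`, as a `K`-linear endomorphism. -/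
noncomputable def mulMap {A : Type} (V : Type) [CommRing A] [Algebra K A] [AddCommGroup V]
    [Module K V] [Module A V] [IsScalarTower K A V] (g : A) : Module.End K V :=
  (LinearMap.lsmul A V g).restrictScalars K

/-- The endomorphism `f` of the graded vector space `ℳ` (supported between
degrees `a` and `b`) is a weak Lefschetz operator: each `f : ℳ i → ℳ (i+1)` is
injective or surjective. -/
def IsWLEndo {V : Type} [AddCommGroup V] [Module K V]
    (ℳ : ℤ → Submodule K V) (a b : ℤ) (f : Module.End K V) : Prop :=
  ∀ i : ℤ, a ≤ i → i + 1 ≤ b →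
    ((∀ v ∈ ℳ i, f v = 0 → v = 0) ∨ (∀ w ∈ ℳ (i + 1), ∃ v ∈ ℳ i, f v = w))

/-- The endomorphism `f` of the graded vector space `ℳ` (supported between
degrees `a` and `b`) is a strong Lefschetz operator:
`f^(b-a-2i) : ℳ (a+i) → ℳ (b-i)` is bijective for all `0 ≤ 2i ≤ b-a`. -/
def IsSLEndo {V : Type} [AddCommGroup V] [Module K V]
    (ℳ : ℤ → Submodule K V) (a b : ℤ) (f : Module.End K V) : Prop :=
  ∀ i : ℕ, 2 * (i : ℤ) ≤ b - a →
    (∀ v ∈ ℳ (a + i), (f ^ (b - a - 2 * i).toNat) v = 0 → v = 0) ∧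
    (∀ w ∈ ℳ (b - i), ∃ v ∈ ℳ (a + i), (f ^ (b - a - 2 * i).toNat) v = w)

/-- `g ∈ A₁` is a weak Lefschetz element for the graded module `(V, ℳ)`. -/
def IsWLElem {A V : Type} [CommRing A] [Algebra K A] [AddCommGroup V]
    [Module K V] [Module A V] [IsScalarTower K A V]
    (𝒜 : ℕ → Submodule K A) (ℳ : ℤ → Submodule K V) (a b : ℤ) (g : A) : Prop :=
  g ∈ 𝒜 1 ∧ IsWLEndo K ℳ a b (mulMap K V g)

/-- `g ∈ A₁` is a strong Lefschetz element for the graded module `(V, ℳ)`. -/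
def IsSLElem {A V : Type} [CommRing A] [Algebra K A] [AddCommGroup V]
    [Module K V] [Module A V] [IsScalarTower K A V]
    (𝒜 : ℕ → Submodule K A) (ℳ : ℤ → Submodule K V) (a b : ℤ) (g : A) : Prop :=
  g ∈ 𝒜 1 ∧ IsSLEndo K ℳ a b (mulMap K V g)

/-- The Hilbert function of the graded vector space `ℳ`. -/
noncomputable def hilb {V : Type} [AddCommGroup V] [Module K V]
    (ℳ : ℤ → Submodule K V) (i : ℤ) : ℕ :=
  Module.finrank K (ℳ i)

/-- The Hilbert function of `ℳ`, supported between `a` and `b`, is symmetric. -/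
def SymHilb {V : Type} [AddCommGroup V] [Module K V]
    (ℳ : ℤ → Submodule K V) (a b : ℤ) : Prop :=
  ∀ i : ℤ, hilb K ℳ (a + i) = hilb K ℳ (b - i)

/-- The Hilbert function of `ℳ`, supported between `a` and `b`, is unimodal. -/
def UnimodalHilb {V : Type} [AddCommGroup V] [Module K V]
    (ℳ : ℤ → Submodule K V) (a b : ℤ) : Prop :=
  ∃ m : ℤ, a ≤ m ∧ m ≤ b ∧
    (∀ i j : ℤ, a ≤ i → i ≤ j → j ≤ m → hilb K ℳ i ≤ hilb K ℳ j) ∧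
    (∀ i j : ℤ, m ≤ i → i ≤ j → j ≤ b → hilb K ℳ j ≤ hilb K ℳ i)

/-- The Sperner number of `ℳ` (supported between `a` and `b`). -/
noncomputable def sperner {V : Type} [AddCommGroup V] [Module K V]
    (ℳ : ℤ → Submodule K V) (a b : ℤ) : ℕ :=
  (Finset.Icc a b).sup fun i => hilb K ℳ i

/-- The CoSperner number of `ℳ` (supported between `a` and `b`). -/
noncomputable def coSperner {V : Type} [AddCommGroup V] [Module K V]
    (ℳ : ℤ → Submodule K V) (a b : ℤ) : ℕ :=
  ∑ i ∈ Finset.Icc a (b - 1), min (hilb K ℳ i) (hilb K ℳ (i + 1))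

/-- `SP_k(V) = Σ_{i=a}^{b} max (dim V_i - dim V_{i-k}) 0` (via truncated
subtraction on `ℕ`). -/
noncomputable def spernerVec {V : Type} [AddCommGroup V] [Module K V]
    (ℳ : ℤ → Submodule K V) (a b : ℤ) (k : ℕ) : ℕ :=
  ∑ i ∈ Finset.Icc a b, (hilb K ℳ i - hilb K ℳ (i - (k : ℤ)))

/-- `d` is the multiset of Jordan block sizes of the (nilpotent) endomorphism `f`:
all entries are positive and `dim ker f^k = Σ_{n ∈ d} min n k` for every `k`. -/
def IsJordanType {V : Type} [AddCommGroup V] [Module K V]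
    (f : Module.End K V) (d : Multiset ℕ) : Prop :=
  (∀ n ∈ d, 0 < n) ∧
  ∀ k : ℕ, Module.finrank K (LinearMap.ker (f ^ k)) = (d.map fun n => min n k).sum

/-- `g ∈ A₁` is a weak Lefschetz element of the graded algebra `(A, 𝒜)` with top
degree `c`. -/
def IsAlgWLElem {A : Type} [CommRing A] [Algebra K A]
    (𝒜 : ℕ → Submodule K A) (c : ℕ) (g : A) : Prop :=
  g ∈ 𝒜 1 ∧ ∀ i : ℕ, i + 1 ≤ c →
    ((∀ v ∈ 𝒜 i, g * v = 0 → v = 0) ∨ (∀ w ∈ 𝒜 (i + 1), ∃ v ∈ 𝒜 i, g * v = w))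

/-- `g ∈ A₁` is a strong Lefschetz element of the graded algebra `(A, 𝒜)` with top
degree `c`: `×g^(c-2i) : A_i → A_{c-i}` is bijective for `0 ≤ 2i ≤ c`. -/
def IsAlgSLElem {A : Type} [CommRing A] [Algebra K A]
    (𝒜 : ℕ → Submodule K A) (c : ℕ) (g : A) : Prop :=
  g ∈ 𝒜 1 ∧ ∀ i : ℕ, 2 * i ≤ c →
    (∀ v ∈ 𝒜 i, g ^ (c - 2 * i) * v = 0 → v = 0) ∧
    (∀ w ∈ 𝒜 (c - i), ∃ v ∈ 𝒜 i, g ^ (c - 2 * i) * v = w)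

/-- The graded algebra `(A, 𝒜)` has the weak Lefschetz property. -/
def AlgHasWLP {A : Type} [CommRing A] [Algebra K A] (𝒜 : ℕ → Submodule K A) : Prop :=
  ∃ c : ℕ, GradedTop K 𝒜 c ∧ ∃ g : A, IsAlgWLElem K 𝒜 c g

/-- The graded algebra `(A, 𝒜)` has the strong Lefschetz property. -/
def AlgHasSLP {A : Type} [CommRing A] [Algebra K A] (𝒜 : ℕ → Submodule K A) : Prop :=
  ∃ c : ℕ, GradedTop K 𝒜 c ∧ ∃ g : A, IsAlgSLElem K 𝒜 c g

/-- The graded pieces of the tensor product `V ⊗[K] W` of two graded vector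
spaces: `(ℳ ⊗ 𝒩)_k = Σ_{i+j=k} ℳ_i ⊗ 𝒩_j`. -/
noncomputable def tensorGrading {V W : Type} [AddCommGroup V] [Module K V]
    [AddCommGroup W] [Module K W] (ℳ : ℤ → Submodule K V) (𝒩 : ℤ → Submodule K W)
    (k : ℤ) : Submodule K (V ⊗[K] W) :=
  ⨆ i : ℤ, LinearMap.range (TensorProduct.map (ℳ i).subtype (𝒩 (k - i)).subtype)

/-- Reindex a `ℕ`-indexed grading by `ℤ`. -/
noncomputable def natToZ {V : Type} [AddCommGroup V] [Module K V]
    (ℒ : ℕ → Submodule K V) (i : ℤ) : Submodule K V :=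
  if 0 ≤ i then ℒ i.toNat else ⊥

/-- The truncated polynomial ring `K[t]/(t^α)`. -/
abbrev TruncPoly (α : ℕ) : Type :=
  Polynomial K ⧸ Ideal.span {(Polynomial.X : Polynomial K) ^ α}

/-- The image of `t` in `K[t]/(t^α)`. -/
noncomputable def tbar (α : ℕ) : TruncPoly K α :=
  Ideal.Quotient.mk _ Polynomial.X

/-- The standard grading of `K[t]/(t^α)` (with `deg t = 1`): the degree-`j` piece
is spanned by the class of `t^j` for `0 ≤ j < α`, and is zero otherwise. -/
noncomputable def truncGrading (α : ℕ) (j : ℤ) : Submodule K (TruncPoly K α) :=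
  if 0 ≤ j ∧ j < (α : ℤ) then Submodule.span K {tbar K α ^ j.toNat} else ⊥

end LefschetzPrelude

/-- The dimension of a finite sup of independent subspaces is the sum of the dimensions. -/
theorem finrank_finsetSup_of_iSupIndep {K V ι : Type*} [Field K] [AddCommGroup V] [Module K V]
    [FiniteDimensional K V] {p : ι → Submodule K V} (hp : iSupIndep p) (s : Finset ι) :
    Module.finrank K (s.sup p : Submodule K V) = ∑ i ∈ s, Module.finrank K (p i) := by
  classical
  induction s using Finset.induction_on with
  | empty => simp
  | insert i s hi ih =>
    have hdisj : Disjoint (p i) (s.sup p) :=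
      hp.supIndep' (insert i s) (Finset.subset_insert i s) (Finset.mem_insert_self i s) hi
    have h := Submodule.finrank_sup_add_finrank_inf_eq (p i) (s.sup p)
    rw [hdisj.eq_bot, finrank_bot, add_zero, ih] at h
    rw [Finset.sup_insert, Finset.sum_insert hi, h]

/-- A family that vanishes outside `s` has the same supremum over `s` as over all indices. -/
theorem iSup_eq_finsetSup_of_forall_eq_bot {α ι : Type*} [CompleteLattice α] {p : ι → α}
    {s : Finset ι} (h : ∀ i ∉ s, p i = ⊥) : ⨆ i, p i = s.sup p := by
  refine le_antisymm (iSup_le fun i => ?_) (Finset.sup_le fun i _ => le_iSup p i)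
  by_cases hi : i ∈ s
  · exact Finset.le_sup hi
  · simp [h i hi]

/-- A subspace has image of full dimension iff the map has no kernel on it. -/
theorem finrank_map_eq_iff_injective_on {K V W : Type*} [Field K] [AddCommGroup V] [Module K V]
    [AddCommGroup W] [Module K W] [FiniteDimensional K V] (f : V →ₗ[K] W) (p : Submodule K V) :
    Module.finrank K (p.map f) = Module.finrank K p ↔ ∀ v ∈ p, f v = 0 → v = 0 := by
  have h := LinearMap.finrank_range_add_finrank_ker (f.domRestrict p)
  rw [LinearMap.range_domRestrict] at h
  have h0 : Module.finrank K (p.map f) = Module.finrank K p ↔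
      Module.finrank K (LinearMap.ker (f.domRestrict p)) = 0 := by omega
  rw [h0, Submodule.finrank_eq_zero, LinearMap.ker_eq_bot']
  simp [LinearMap.domRestrict_apply]

/-- The weak Lefschetz condition in one degree is maximality of the rank in that degree. -/
theorem injective_or_surjective_iff_finrank_map {K V W : Type*} [Field K]
    [AddCommGroup V] [Module K V] [AddCommGroup W] [Module K W]
    [FiniteDimensional K V] [FiniteDimensional K W]
    (f : V →ₗ[K] W) {p : Submodule K V} {q : Submodule K W} (hpq : p.map f ≤ q) :
    ((∀ v ∈ p, f v = 0 → v = 0) ∨ (∀ w ∈ q, ∃ v ∈ p, f v = w)) ↔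
      Module.finrank K (p.map f) = min (Module.finrank K p) (Module.finrank K q) := by
  have hp := Submodule.finrank_map_le f p
  have hq := Submodule.finrank_mono hpq
  have hsurj : (∀ w ∈ q, ∃ v ∈ p, f v = w) ↔
      Module.finrank K (p.map f) = Module.finrank K q :=
    ⟨fun h => by rw [le_antisymm hpq fun w hw => h w hw],
      fun h w hw => by rwa [← Submodule.eq_of_le_of_finrank_eq hpq h] at hw⟩
  rw [hsurj, ← finrank_map_eq_iff_injective_on]
  omega

/-- For a function on `[a, b]` with peak `m`, the sum of the values is the peak value plus the sum
of the minima of consecutive values. -/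
theorem sum_Icc_eq_peak_add_sum_min {h : ℤ → ℕ} {a m b : ℤ} (ham : a ≤ m) (hmb : m ≤ b)
    (hinc : ∀ i j : ℤ, a ≤ i → i ≤ j → j ≤ m → h i ≤ h j)
    (hdec : ∀ i j : ℤ, m ≤ i → i ≤ j → j ≤ b → h j ≤ h i) :
    ∑ i ∈ Finset.Icc a b, h i = h m + ∑ i ∈ Finset.Icc a (b - 1), min (h i) (h (i + 1)) := by
  have hsplit : Finset.Icc a b = insert m (Finset.Ico a m ∪ Finset.Ioc m b) := by
    ext i; simp only [Finset.mem_Icc, Finset.mem_insert, Finset.mem_union, Finset.mem_Ico,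
      Finset.mem_Ioc]; omega
  have hsplit' : Finset.Icc a (b - 1) = Finset.Ico a m ∪ Finset.Ico m b := by
    ext i; simp only [Finset.mem_Icc, Finset.mem_union, Finset.mem_Ico]; omega
  have hleft : ∑ i ∈ Finset.Ico a m, min (h i) (h (i + 1)) = ∑ i ∈ Finset.Ico a m, h i := by
    refine Finset.sum_congr rfl fun i hi => min_eq_left ?_
    rw [Finset.mem_Ico] at hi
    exact hinc _ _ (by omega) (by omega) (by omega)
  have hright : ∑ i ∈ Finset.Ico m b, min (h i) (h (i + 1)) = ∑ i ∈ Finset.Ioc m b, h i := by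
    refine Finset.sum_bij (fun i _ => i + 1) ?_ ?_ ?_ ?_
    · intro i hi; rw [Finset.mem_Ico] at hi; rw [Finset.mem_Ioc]; omega
    · intro i _ j _ hij; omega
    · intro j hj; rw [Finset.mem_Ioc] at hj
      exact ⟨j - 1, by rw [Finset.mem_Ico]; omega, by omega⟩
    · intro i hi; rw [Finset.mem_Ico] at hi
      exact min_eq_right (hdec _ _ (by omega) (by omega) (by omega))
  rw [hsplit, hsplit', Finset.sum_insert (by simp), Finset.sum_union, Finset.sum_union,
    hleft, hright]
  · rw [Finset.disjoint_left]; intro i; simp only [Finset.mem_Ico]; omega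
  · rw [Finset.disjoint_left]; intro i; simp only [Finset.mem_Ico, Finset.mem_Ioc]; omega

section GradedEndo

variable {K V : Type} [Field K] [AddCommGroup V] [Module K V]

theorem sperner_eq_hilb_of_peak {ℳ : ℤ → Submodule K V} {a m b : ℤ} (ham : a ≤ m) (hmb : m ≤ b)
    (hinc : ∀ i j : ℤ, a ≤ i → i ≤ j → j ≤ m → hilb K ℳ i ≤ hilb K ℳ j)
    (hdec : ∀ i j : ℤ, m ≤ i → i ≤ j → j ≤ b → hilb K ℳ j ≤ hilb K ℳ i) :
    sperner K ℳ a b = hilb K ℳ m := by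
  refine le_antisymm (Finset.sup_le fun i hi => ?_)
    (Finset.le_sup (f := fun i => hilb K ℳ i) (Finset.mem_Icc.2 ⟨ham, hmb⟩))
  rw [Finset.mem_Icc] at hi
  rcases le_total i m with him | hmi
  · exact hinc i m hi.1 him le_rfl
  · exact hdec m i le_rfl hmi hi.2

variable [FiniteDimensional K V] {ℳ : ℤ → Submodule K V} {a b : ℤ}

/-- For a unimodal Hilbert function, the Sperner and CoSperner numbers add up to the dimension. -/
theorem finrank_eq_sperner_add_coSperner (hint : DirectSum.IsInternal ℳ)
    (hbd : GradedBetween K ℳ a b) (huni : UnimodalHilb K ℳ a b) :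
    Module.finrank K V = sperner K ℳ a b + coSperner K ℳ a b := by
  obtain ⟨m, ham, hmb, hinc, hdec⟩ := huni
  have htop : (Finset.Icc a b).sup ℳ = ⊤ := by
    rw [← hint.submodule_iSup_eq_top]
    refine (iSup_eq_finsetSup_of_forall_eq_bot fun i hi => hbd.2.2.2 i ?_).symm
    rw [Finset.mem_Icc] at hi
    omega
  rw [sperner_eq_hilb_of_peak ham hmb hinc hdec, coSperner,
    ← sum_Icc_eq_peak_add_sum_min ham hmb hinc hdec, ← finrank_top K V, ← htop,
    finrank_finsetSup_of_iSupIndep hint.submodule_iSupIndep]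
  rfl

/-- The rank of a homogeneous endomorphism of degree one is the sum of its ranks in each degree. -/
theorem finrank_range_eq_sum_finrank_map (hint : DirectSum.IsInternal ℳ)
    (hbd : GradedBetween K ℳ a b) {f : Module.End K V}
    (hf : ∀ i, (ℳ i).map f ≤ ℳ (i + 1)) :
    Module.finrank K (LinearMap.range f) =
      ∑ i ∈ Finset.Icc a (b - 1), Module.finrank K ((ℳ i).map f) := by
  have hindep : iSupIndep fun i => (ℳ i).map f :=
    (hint.submodule_iSupIndep.comp (add_left_injective (1 : ℤ))).mono hf
  rw [← finrank_finsetSup_of_iSupIndep hindep, LinearMap.range_eq_map,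
    ← hint.submodule_iSup_eq_top, Submodule.map_iSup, iSup_eq_finsetSup_of_forall_eq_bot]
  intro i hi
  rw [Finset.mem_Icc] at hi
  by_cases hia : i < a
  · rw [hbd.2.2.2 i (Or.inl hia), Submodule.map_bot]
  · exact eq_bot_iff.2 ((hf i).trans (hbd.2.2.2 (i + 1) (by omega)).le)

/-- A homogeneous endomorphism of degree one is weak Lefschetz iff its rank is the CoSperner
number. -/
theorem isWLEndo_iff_finrank_range_eq_coSperner (hint : DirectSum.IsInternal ℳ)
    (hbd : GradedBetween K ℳ a b) {f : Module.End K V}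
    (hf : ∀ i, (ℳ i).map f ≤ ℳ (i + 1)) :
    IsWLEndo K ℳ a b f ↔ Module.finrank K (LinearMap.range f) = coSperner K ℳ a b := by
  rw [finrank_range_eq_sum_finrank_map hint hbd hf, coSperner]
  unfold hilb
  rw [Finset.sum_eq_sum_iff_of_le fun i _ =>
      le_min (Submodule.finrank_map_le f (ℳ i)) (Submodule.finrank_mono (hf i))]
  refine forall_congr' fun i => ?_
  rw [injective_or_surjective_iff_finrank_map f (hf i), Finset.mem_Icc, and_imp, le_sub_iff_add_le]

end GradedEndo

/-- Lemma 2.3. Let `A` be a graded Artinian `K`-algebra and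
`V = ⊕_{i=a}^{b} V_i` a finite graded `A`-module with unimodal Hilbert function.
For a linear form `ℓ ∈ A₁` the following are equivalent:
(1) `ℓ` is a weak Lefschetz element of `V`;
(2) `dim V/ℓV = Sperner(V)`;
(3) `rank (×ℓ) = CoSperner(V)`. -/
theorem statement_0 {K A V : Type} [Field K] [CommRing A] [Algebra K A]
    [AddCommGroup V] [Module K V] [Module A V] [IsScalarTower K A V]
    (𝒜 : ℕ → Submodule K A) (ℳ : ℤ → Submodule K V) (a b : ℤ)
    (hA : IsGradedArtinAlg K 𝒜) (hM : IsGradedMod K 𝒜 ℳ)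
    (hbd : GradedBetween K ℳ a b) (huni : UnimodalHilb K ℳ a b)
    (ℓ : A) (hℓ : ℓ ∈ 𝒜 1) :
    (IsWLEndo K ℳ a b (mulMap K V ℓ) ↔
      Module.finrank K (V ⧸ LinearMap.range (mulMap K V ℓ)) = sperner K ℳ a b) ∧
    (IsWLEndo K ℳ a b (mulMap K V ℓ) ↔
      Module.finrank K (LinearMap.range (mulMap K V ℓ)) = coSperner K ℳ a b) := by
  obtain ⟨hint, hsmul, hfin⟩ := hM
  have hf : ∀ i, (ℳ i).map (mulMap K V ℓ) ≤ ℳ (i + 1) := by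
    rintro i _ ⟨v, hv, rfl⟩
    exact hsmul 1 i ℓ hℓ v hv
  have hrank := isWLEndo_iff_finrank_range_eq_coSperner hint hbd hf
  have hdim := finrank_eq_sperner_add_coSperner hint hbd huni
  have hquot := Submodule.finrank_quotient_add_finrank (LinearMap.range (mulMap K V ℓ))
  refine ⟨hrank.trans ?_, hrank⟩
  omega
end

section
/- Let K be a field, A a graded Artinian K-algebra, and V = ⊕_{i=a}^{b} V_i a finite graded A-module whose Hilbert function is symmetric and unimodal, with V_a ≠ 0 and V_b ≠ 0. Then for a linear form g ∈ A_1 the following are equivalent: (1) g is a strong Lefschetz element of V; (2) dim_K V/g^k V = SP_k(V) for all k = 1, 2, ..., b−a; (3) the rank of the multiplication map ×g^k : V → V equals dim_K V − SP_k(V) for all k = 1, 2, ..., b−a. -/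
set_option maxHeartbeats 1000000
set_option synthInstance.maxHeartbeats 400000

open TensorProduct

/-- The dimension of an independent supremum supported on a finset is the sum of the dimensions. -/
theorem finrank_iSup_eq_sum_of_iSupIndep {K V ι : Type*} [Field K] [AddCommGroup V] [Module K V]
    [FiniteDimensional K V] {N : ι → Submodule K V} (hN : iSupIndep N) (s : Finset ι)
    (hs : ∀ i ∉ s, N i = ⊥) :
    Module.finrank K (⨆ i, N i : Submodule K V) = ∑ i ∈ s, Module.finrank K (N i) := by
  classical
  have hsup : ⨆ i, N i = s.sup N := by
    refine le_antisymm (iSup_le fun i => ?_) (Finset.sup_le fun i _ => le_iSup N i)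
    by_cases hi : i ∈ s
    · exact Finset.le_sup hi
    · simp [hs i hi]
  rw [hsup]
  clear hs hsup
  induction s using Finset.induction_on with
  | empty => simp
  | insert i s hi ih =>
    have hd : Disjoint (N i) (s.sup N) :=
      (hN i).mono_right <| Finset.sup_le fun j hj =>
        le_iSup₂_of_le j (by rintro rfl; exact hi hj) le_rfl
    have h := Submodule.finrank_sup_add_finrank_inf_eq (N i) (s.sup N)
    rw [hd.eq_bot, finrank_bot, add_zero] at h
    rw [Finset.sup_insert, Finset.sum_insert hi, h, ih]

theorem mulMap_pow {K A : Type} (V : Type) [Field K] [CommRing A] [Algebra K A]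
    [AddCommGroup V] [Module K V] [Module A V] [IsScalarTower K A V] (g : A) (k : ℕ) :
    mulMap K V (g ^ k) = mulMap K V g ^ k := by
  induction k with
  | zero => ext v; simp [mulMap]
  | succ k ih =>
    rw [pow_succ (mulMap K V g), ← ih, pow_succ]
    ext v
    exact mul_smul (g ^ k) g v

section GradedEndo

variable {K V : Type} [Field K] [AddCommGroup V] [Module K V] {ℳ : ℤ → Submodule K V}

theorem pow_mem_of_degree_one {f : Module.End K V} (hf : ∀ j, ∀ v ∈ ℳ j, f v ∈ ℳ (j + 1))
    (k : ℕ) {j : ℤ} {v : V} (hv : v ∈ ℳ j) : (f ^ k) v ∈ ℳ (j + k) := by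
  induction k with
  | zero => simpa using hv
  | succ k ih =>
    rw [pow_succ', Module.End.mul_apply]
    have := hf _ _ ih
    rwa [add_assoc] at this

theorem map_pow_le_of_degree_one {f : Module.End K V} (hf : ∀ j, ∀ v ∈ ℳ j, f v ∈ ℳ (j + 1))
    (k : ℕ) (i : ℤ) : (ℳ (i - k)).map (f ^ k) ≤ ℳ i := by
  rintro _ ⟨v, hv, rfl⟩
  simpa using pow_mem_of_degree_one hf k hv

variable [FiniteDimensional K V] {a b : ℤ}

theorem finrank_map_pow_le_min {f : Module.End K V}
    (hf : ∀ j, ∀ v ∈ ℳ j, f v ∈ ℳ (j + 1)) (k : ℕ) (i : ℤ) :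
    Module.finrank K ((ℳ (i - k)).map (f ^ k)) ≤ min (hilb K ℳ i) (hilb K ℳ (i - k)) :=
  le_min (Submodule.finrank_mono (map_pow_le_of_degree_one hf k i))
    (Submodule.finrank_map_le _ _)

theorem finrank_eq_sum_hilb (hM : DirectSum.IsInternal ℳ) (hbd : GradedBetween K ℳ a b) :
    Module.finrank K V = ∑ i ∈ Finset.Icc a b, hilb K ℳ i := by
  have h := finrank_iSup_eq_sum_of_iSupIndep hM.submodule_iSupIndep (Finset.Icc a b)
    fun i hi => hbd.2.2.2 i (by simp only [Finset.mem_Icc] at hi; omega)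
  rwa [hM.submodule_iSup_eq_top, finrank_top] at h

theorem finrank_range_pow_eq_sum (hM : DirectSum.IsInternal ℳ) (hbd : GradedBetween K ℳ a b)
    {f : Module.End K V} (hf : ∀ j, ∀ v ∈ ℳ j, f v ∈ ℳ (j + 1)) (k : ℕ) :
    Module.finrank K (LinearMap.range (f ^ k)) =
      ∑ i ∈ Finset.Icc a b, Module.finrank K ((ℳ (i - k)).map (f ^ k)) := by
  have hle := map_pow_le_of_degree_one hf k
  have hrange : LinearMap.range (f ^ k) = ⨆ i : ℤ, (ℳ (i - k)).map (f ^ k) := by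
    rw [← Submodule.map_iSup, ← Submodule.map_top, ← hM.submodule_iSup_eq_top]
    exact congrArg _ ((Equiv.subRight (k : ℤ)).iSup_comp (g := ℳ)).symm
  rw [hrange]
  refine finrank_iSup_eq_sum_of_iSupIndep (hM.submodule_iSupIndep.mono hle) _ fun i hi => ?_
  rw [← le_bot_iff, ← hbd.2.2.2 i (by simp only [Finset.mem_Icc] at hi; omega)]
  exact hle i

theorem sum_min_hilb_add_spernerVec (hM : DirectSum.IsInternal ℳ)
    (hbd : GradedBetween K ℳ a b) (k : ℕ) :
    ∑ i ∈ Finset.Icc a b, min (hilb K ℳ i) (hilb K ℳ (i - k)) + spernerVec K ℳ a b k =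
      Module.finrank K V := by
  rw [finrank_eq_sum_hilb hM hbd, spernerVec, ← Finset.sum_add_distrib]
  exact Finset.sum_congr rfl fun i _ => by omega

/-- The rank of `f ^ k` is `dim V - SP_k(V)` iff `f ^ k` has full rank in every degree. -/
theorem finrank_range_pow_add_spernerVec_iff (hM : DirectSum.IsInternal ℳ)
    (hbd : GradedBetween K ℳ a b) {f : Module.End K V}
    (hf : ∀ j, ∀ v ∈ ℳ j, f v ∈ ℳ (j + 1)) (k : ℕ) :
    Module.finrank K (LinearMap.range (f ^ k)) + spernerVec K ℳ a b k = Module.finrank K V ↔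
      ∀ i ∈ Finset.Icc a b, Module.finrank K ((ℳ (i - k)).map (f ^ k)) =
        min (hilb K ℳ i) (hilb K ℳ (i - k)) := by
  rw [← sum_min_hilb_add_spernerVec hM hbd k, add_left_inj, finrank_range_pow_eq_sum hM hbd hf,
    Finset.sum_eq_sum_iff_of_le fun i _ => finrank_map_pow_le_min hf k i]

theorem finrank_map_eq_iff {p : Submodule K V} {F : Module.End K V} :
    Module.finrank K (p.map F) = Module.finrank K p ↔ ∀ v ∈ p, F v = 0 → v = 0 := by
  have hker := LinearMap.finrank_range_add_finrank_ker (F.domRestrict p)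
  rw [LinearMap.range_domRestrict] at hker
  rw [← hker, left_eq_add, Submodule.finrank_eq_zero, LinearMap.ker_eq_bot']
  simp

/-- Strong Lefschetz operators on a graded space with symmetric Hilbert function are exactly
those whose powers have full rank in every degree. -/
theorem isSLEndo_iff_finrank_map_pow (hbd : GradedBetween K ℳ a b) (hsym : SymHilb K ℳ a b)
    {f : Module.End K V} (hf : ∀ j, ∀ v ∈ ℳ j, f v ∈ ℳ (j + 1)) :
    IsSLEndo K ℳ a b f ↔ ∀ k : ℕ, 1 ≤ k → (k : ℤ) ≤ b - a →
      ∀ i ∈ Finset.Icc a b, Module.finrank K ((ℳ (i - k)).map (f ^ k)) =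
        min (hilb K ℳ i) (hilb K ℳ (i - k)) := by
  constructor
  · intro h k _ _ i hi
    rw [Finset.mem_Icc] at hi
    refine le_antisymm (finrank_map_pow_le_min hf k i) ?_
    rcases lt_or_ge (i - k) a with hlt | hge
    · rw [hilb, hilb, hbd.2.2.2 _ (Or.inl hlt)]
      simp
    rcases le_total (2 * i - k) (a + b) with hle | hle
    · obtain ⟨n, hn⟩ : ∃ n : ℕ, i - k = a + n := ⟨(i - k - a).toNat, by omega⟩
      obtain ⟨hinj, -⟩ := h n (by omega)
      obtain ⟨m, hm⟩ : ∃ m : ℕ, (b - a - 2 * n).toNat = m + k :=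
        ⟨(b - a - 2 * n).toNat - k, by omega⟩
      refine (min_le_right _ _).trans (finrank_map_eq_iff.2 fun v hv hv0 => ?_).ge
      refine hinj v (hn ▸ hv) ?_
      rw [hm, pow_add, Module.End.mul_apply, hv0, map_zero]
    · obtain ⟨n, hn⟩ : ∃ n : ℕ, i = b - n := ⟨(b - i).toNat, by omega⟩
      obtain ⟨-, hsurj⟩ := h n (by omega)
      obtain ⟨m, hm⟩ : ∃ m : ℕ, (b - a - 2 * n).toNat = k + m :=
        ⟨(b - a - 2 * n).toNat - k, by omega⟩
      refine (min_le_left _ _).trans (Submodule.finrank_mono fun w hw => ?_)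
      obtain ⟨v, hv, rfl⟩ := hsurj w (hn ▸ hw)
      have hmem := pow_mem_of_degree_one hf m hv
      rw [show a + n + m = i - k by omega] at hmem
      exact ⟨_, hmem, by rw [hm, pow_add, Module.End.mul_apply]⟩
  · intro h n hn
    obtain ⟨k, hk⟩ : ∃ k : ℕ, (k : ℤ) = b - a - 2 * n := ⟨(b - a - 2 * n).toNat, by omega⟩
    rw [show (b - a - 2 * n).toNat = k by omega]
    rcases Nat.eq_zero_or_pos k with rfl | hpos
    · have : a + n = b - n := by omega
      simp [this]
    have h := h k hpos (by omega) (b - n) (by rw [Finset.mem_Icc]; omega)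
    rw [show b - n - k = a + n by omega, hsym n, min_self] at h
    have hle := map_pow_le_of_degree_one hf k (b - n)
    rw [show b - n - k = a + n by omega] at hle
    constructor
    · exact finrank_map_eq_iff.1 (h.trans (hsym n).symm)
    · intro w hw
      rw [← Submodule.eq_of_le_of_finrank_eq hle h] at hw
      exact hw

end GradedEndo

/-- Lemma 2.4. Let `A` be a graded Artinian `K`-algebra and
`V = ⊕_{i=a}^{b} V_i` a finite graded `A`-module with symmetric unimodal Hilbert
function.  For a linear form `g ∈ A₁` the following are equivalent:
(1) `g` is a strong Lefschetz element of `V`;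
(2) `dim V/g^k V = SP_k(V)` for all `k = 1, …, b-a`;
(3) `rank (×g^k) = dim V - SP_k(V)` for all `k = 1, …, b-a`. -/
theorem statement_1 {K A V : Type} [Field K] [CommRing A] [Algebra K A]
    [AddCommGroup V] [Module K V] [Module A V] [IsScalarTower K A V]
    (𝒜 : ℕ → Submodule K A) (ℳ : ℤ → Submodule K V) (a b : ℤ)
    (hA : IsGradedArtinAlg K 𝒜) (hM : IsGradedMod K 𝒜 ℳ)
    (hbd : GradedBetween K ℳ a b) (hsym : SymHilb K ℳ a b)
    (huni : UnimodalHilb K ℳ a b)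
    (g : A) (hg : g ∈ 𝒜 1) :
    (IsSLEndo K ℳ a b (mulMap K V g) ↔
      ∀ k : ℕ, 1 ≤ k → (k : ℤ) ≤ b - a →
        Module.finrank K (V ⧸ LinearMap.range (mulMap K V (g ^ k))) =
          spernerVec K ℳ a b k) ∧
    (IsSLEndo K ℳ a b (mulMap K V g) ↔
      ∀ k : ℕ, 1 ≤ k → (k : ℤ) ≤ b - a →
        Module.finrank K (LinearMap.range (mulMap K V (g ^ k))) =
          Module.finrank K V - spernerVec K ℳ a b k) := by
  obtain ⟨hint, hmul, hfin⟩ := hM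
  have hf : ∀ j, ∀ v ∈ ℳ j, mulMap K V g v ∈ ℳ (j + 1) := fun j v hv => by
    simpa [mulMap] using hmul 1 j g hg v hv
  rw [isSLEndo_iff_finrank_map_pow hbd hsym hf]
  constructor <;> refine forall_congr' fun k => forall₂_congr fun _ _ =>
    (finrank_range_pow_add_spernerVec_iff hint hbd hf k).symm.trans ?_
  · rw [mulMap_pow]
    have := Submodule.finrank_quotient_add_finrank (LinearMap.range (mulMap K V g ^ k))
    omega
  · rw [mulMap_pow]
    have := sum_min_hilb_add_spernerVec hint hbd k
    omega
end

section
/- Let K be a field of characteristic zero, A and B graded Artinian K-algebras, V a finite graded A-module with the SLP and W a finite graded B-module with the SLP. Then V ⊗_K W has the SLP as a graded A ⊗_K B-module; moreover, if g ∈ A_1 is a strong Lefschetz element of V and h ∈ B_1 is a strong Lefschetz element of W, then g ⊗ 1 + 1 ⊗ h is a strong Lefschetz element of V ⊗_K W. -/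
set_option maxHeartbeats 1000000
set_option synthInstance.maxHeartbeats 400000

open TensorProduct

section SlTwo

variable {K U : Type*} [Field K] [AddCommGroup U] [Module K U]

theorem Module.End.pow_apply_mem_shift {T : ℤ → Submodule K U} {f : Module.End K U} {s : ℤ}
    (hf : ∀ d, ∀ u ∈ T d, f u ∈ T (d + s)) (r : ℕ) {d : ℤ} {u : U} (hu : u ∈ T d) :
    (f ^ r) u ∈ T (d + r * s) := by
  induction r with
  | zero => simpa using hu
  | succ r ih =>
    rw [pow_succ', Module.End.mul_apply]
    convert hf _ _ ih using 2
    push_cast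
    ring

theorem Module.End.pow_apply_mem_of_invariant {N : Submodule K U} {f : Module.End K U}
    (hf : ∀ u ∈ N, f u ∈ N) (r : ℕ) {u : U} (hu : u ∈ N) : (f ^ r) u ∈ N := by
  induction r with
  | zero => simpa using hu
  | succ r ih =>
    rw [pow_succ', Module.End.mul_apply]
    exact hf _ ih

/-- `E` and `F` lower and raise the degree by one, preserve `N`, and their commutator acts on the
degree `d` part `T d` as the scalar `2 * d - s`. -/
structure IsLoweringRaising (E F : Module.End K U) (N : Submodule K U) (T : ℤ → Submodule K U)
    (s : ℤ) : Prop where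
  lower_mem : ∀ u ∈ N, E u ∈ N
  raise_mem : ∀ u ∈ N, F u ∈ N
  lower_degree : ∀ d, ∀ u ∈ T d, E u ∈ T (d + -1)
  raise_degree : ∀ d, ∀ u ∈ T d, F u ∈ T (d + 1)
  commutator : ∀ d, ∀ u ∈ T d, F (E u) - E (F u) = ((2 * d - s : ℤ) : K) • u

namespace IsLoweringRaising

variable {E F : Module.End K U} {N : Submodule K U} {T : ℤ → Submodule K U} {s : ℤ}

theorem raise_lower_pow_sub_mem (h : IsLoweringRaising E F N T s) {e : ℤ} {v : U}
    (hv : v ∈ T e) (hFv : F v ∈ N) (j : ℕ) :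
    F ((E ^ (j + 1)) v) - (((j + 1) * (2 * e - s - j) : ℤ) : K) • (E ^ j) v ∈ N := by
  induction j with
  | zero =>
    have h1 := h.commutator e v hv
    have h2 := h.lower_mem _ hFv
    have h3 : F (E v) - ((2 * e - s : ℤ) : K) • v = E (F v) := by rw [← h1]; abel
    simpa [← h3] using h2
  | succ j ih =>
    have h1 := h.commutator _ _ (Module.End.pow_apply_mem_shift h.lower_degree (j + 1) hv)
    have h2 := h.lower_mem _ ih
    rw [map_sub, map_smul, ← Module.End.mul_apply E (E ^ j), ← pow_succ' E] at h2
    rw [pow_succ' E (j + 1), Module.End.mul_apply]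
    convert h2 using 1
    rw [sub_eq_iff_eq_add] at h1
    rw [h1]
    push_cast
    module

theorem exists_raise_pow_lower_pow_sub_mem [CharZero K] (h : IsLoweringRaising E F N T s) {e : ℤ}
    {v : U} (hv : v ∈ T e) (hFv : F v ∈ N) (w j : ℕ) (hwj : (w + j : ℤ) ≤ 2 * e - s) :
    ∃ c : K, c ≠ 0 ∧ (F ^ w) ((E ^ (w + j)) v) - c • (E ^ j) v ∈ N := by
  induction w with
  | zero => exact ⟨1, one_ne_zero, by simp⟩
  | succ w ih =>
    obtain ⟨c, hc, hmem⟩ := ih (by push_cast at hwj; linarith)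
    have h1 := Module.End.pow_apply_mem_of_invariant h.raise_mem w
      (h.raise_lower_pow_sub_mem hv hFv (w + j))
    set k : ℤ := ((w + j : ℕ) + 1) * (2 * e - s - (w + j : ℕ)) with hk
    have hk0 : k ≠ 0 := by
      push_cast at hwj hk
      rw [hk]
      exact mul_ne_zero (by positivity) (by linarith)
    refine ⟨k * c, mul_ne_zero (by exact_mod_cast hk0) hc, ?_⟩
    rw [map_sub, map_smul, ← Module.End.mul_apply (F ^ w), ← pow_succ] at h1
    rw [add_right_comm]
    convert N.add_mem h1 (N.smul_mem (k : K) hmem) using 1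
    module

theorem exists_raise_pow_sub_mem [CharZero K] (h : IsLoweringRaising E F N T s) {d : ℤ} {n : ℕ}
    (hn : 2 * d - s = n) (r : ℕ) {u : U} (hu : u ∈ T d) (hr : (F ^ r) u ∈ N) :
    ∃ u' ∈ T (d - n), (F ^ n) u' - u ∈ N := by
  induction r generalizing u with
  | zero => exact ⟨0, Submodule.zero_mem _, by simpa using hr⟩
  | succ r ih =>
    set v := (F ^ r) u with hvdef
    have hv : v ∈ T (d + r) := by
      simpa using Module.End.pow_apply_mem_shift h.raise_degree r hu
    have hFv : F v ∈ N := by rwa [pow_succ', Module.End.mul_apply] at hr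
    obtain ⟨c, hc, hc'⟩ := h.exists_raise_pow_lower_pow_sub_mem hv hFv r 0 (by push_cast; linarith)
    obtain ⟨c₂, hc₂, hc₂'⟩ :=
      h.exists_raise_pow_lower_pow_sub_mem hv hFv n r (by linarith)
    have hE := Module.End.pow_apply_mem_shift h.lower_degree r hv
    have hE₂ := Module.End.pow_apply_mem_shift h.lower_degree (n + r) hv
    rw [show d + (r : ℤ) + r * -1 = d by ring] at hE
    rw [show d + (r : ℤ) + (n + r : ℕ) * -1 = d - n by push_cast; ring] at hE₂
    obtain ⟨u₁, hu₁, hu₁'⟩ := ih (u := u - c⁻¹ • (E ^ r) v)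
      (Submodule.sub_mem _ hu (Submodule.smul_mem _ _ hE)) (by
        convert N.smul_mem (-c⁻¹) hc' using 1
        rw [map_sub, map_smul, ← hvdef, smul_sub, smul_smul, neg_mul, inv_mul_cancel₀ hc]
        simp only [add_zero, pow_zero, Module.End.one_apply]
        module)
    refine ⟨u₁ + (c⁻¹ * c₂⁻¹) • (E ^ (n + r)) v,
      Submodule.add_mem _ hu₁ (Submodule.smul_mem _ _ hE₂), ?_⟩
    convert N.add_mem hu₁' (N.smul_mem (c⁻¹ * c₂⁻¹) hc₂') using 1
    rw [map_add, map_smul, smul_sub, smul_smul, mul_assoc, inv_mul_cancel₀ hc₂]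
    module

end IsLoweringRaising

end SlTwo

section Strings

variable (K : Type*) [Field K]

/-- The operator on the free module on pairs `(k, l)` sending `(k, l)` to `(k + 1, l) + (k, l + 1)`. -/
noncomputable def stringRaise : Module.End K (ℕ × ℕ →₀ K) :=
  Finsupp.linearCombination K fun x =>
    Finsupp.single (x.1 + 1, x.2) 1 + Finsupp.single (x.1, x.2 + 1) 1

/-- The lowering operator paired with `stringRaise` for strings of lengths `m + 1` and `m' + 1`. -/
noncomputable def stringLower (m m' : ℕ) : Module.End K (ℕ × ℕ →₀ K) :=
  Finsupp.linearCombination K fun x =>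
    ((x.1 : K) * (m + 1 - x.1)) • Finsupp.single (x.1 - 1, x.2) 1 +
      ((x.2 : K) * (m' + 1 - x.2)) • Finsupp.single (x.1, x.2 - 1) 1

theorem stringRaise_single (k l : ℕ) :
    stringRaise K (Finsupp.single (k, l) 1) =
      Finsupp.single (k + 1, l) 1 + Finsupp.single (k, l + 1) 1 := by
  simp [stringRaise]

theorem stringLower_single (m m' k l : ℕ) :
    stringLower K m m' (Finsupp.single (k, l) 1) =
      ((k : K) * (m + 1 - k)) • Finsupp.single (k - 1, l) 1 +
        ((l : K) * (m' + 1 - l)) • Finsupp.single (k, l - 1) 1 := by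
  simp only [stringLower, Finsupp.linearCombination_single, one_smul]

theorem Finsupp.apply_mem_of_mem_supported {α M : Type*} [AddCommGroup M] [Module K M]
    {s : Set α} {f : (α →₀ K) →ₗ[K] M} {P : Submodule K M}
    (h : ∀ x ∈ s, f (Finsupp.single x 1) ∈ P) {u : α →₀ K} (hu : u ∈ Finsupp.supported K K s) :
    f u ∈ P := by
  rw [Finsupp.supported_eq_span_single] at hu
  have : Submodule.span K ((fun i => Finsupp.single i (1 : K)) '' s) ≤ P.comap f := by
    rw [Submodule.span_le]
    rintro _ ⟨x, hx, rfl⟩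
    exact h x hx
  exact this hu

/-- The span of the pairs `(k, l)` with `k + l = d`. -/
noncomputable def stringDegree (d : ℤ) : Submodule K (ℕ × ℕ →₀ K) :=
  Finsupp.supported K K {x | (x.1 + x.2 : ℤ) = d}

/-- The span of the pairs `(k, l)` with `m < k` or `m' < l`. -/
noncomputable def stringTail (m m' : ℕ) : Submodule K (ℕ × ℕ →₀ K) :=
  Finsupp.supported K K {x | m < x.1 ∨ m' < x.2}

theorem isLoweringRaising_string (m m' : ℕ) :
    IsLoweringRaising (stringLower K m m') (stringRaise K) (stringTail K m m') (stringDegree K)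
      (m + m') where
  lower_mem u hu := by
    refine Finsupp.apply_mem_of_mem_supported K ?_ hu
    rintro ⟨k, l⟩ hx
    rw [stringLower_single]
    have hx' : m < k ∨ m' < l := hx
    refine Submodule.add_mem _ ?_ ?_
    · by_cases hk : k = m + 1
      · subst hk
        simp
      · refine Submodule.smul_mem _ _ (Finsupp.single_mem_supported K _ ?_)
        change m < k - 1 ∨ m' < l
        omega
    · by_cases hl : l = m' + 1
      · subst hl
        simp
      · refine Submodule.smul_mem _ _ (Finsupp.single_mem_supported K _ ?_)
        change m < k ∨ m' < l - 1
        omega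
  raise_mem u hu := by
    refine Finsupp.apply_mem_of_mem_supported K ?_ hu
    rintro ⟨k, l⟩ hx
    rw [stringRaise_single]
    have hx' : m < k ∨ m' < l := hx
    refine Submodule.add_mem _ (Finsupp.single_mem_supported K _ ?_)
      (Finsupp.single_mem_supported K _ ?_)
    · change m < k + 1 ∨ m' < l
      omega
    · change m < k ∨ m' < l + 1
      omega
  lower_degree d u hu := by
    refine Finsupp.apply_mem_of_mem_supported K ?_ hu
    rintro ⟨k, l⟩ hx
    rw [stringLower_single]
    have hx' : (k + l : ℤ) = d := hx
    refine Submodule.add_mem _ ?_ ?_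
    · rcases k with _ | k
      · simp
      · refine Submodule.smul_mem _ _ (Finsupp.single_mem_supported K _ ?_)
        change ((k + 1 - 1 : ℕ) + l : ℤ) = d + -1
        omega
    · rcases l with _ | l
      · simp
      · refine Submodule.smul_mem _ _ (Finsupp.single_mem_supported K _ ?_)
        change (k + (l + 1 - 1 : ℕ) : ℤ) = d + -1
        omega
  raise_degree d u hu := by
    refine Finsupp.apply_mem_of_mem_supported K ?_ hu
    rintro ⟨k, l⟩ hx
    rw [stringRaise_single]
    have hx' : (k + l : ℤ) = d := hx
    refine Submodule.add_mem _ (Finsupp.single_mem_supported K _ ?_)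
      (Finsupp.single_mem_supported K _ ?_)
    · change ((k + 1 : ℕ) + l : ℤ) = d + 1
      omega
    · change (k + (l + 1 : ℕ) : ℤ) = d + 1
      omega
  commutator d u hu := by
    rw [← sub_eq_zero, ← Submodule.mem_bot K]
    refine Finsupp.apply_mem_of_mem_supported K
      (f := stringRaise K * stringLower K m m' - stringLower K m m' * stringRaise K -
        ((2 * d - (m + m') : ℤ) : K) • 1) ?_ hu
    rintro ⟨k, l⟩ hx
    have hx' : (k + l : ℤ) = d := hx
    subst hx'
    simp only [LinearMap.sub_apply, Module.End.mul_apply, stringRaise_single, stringLower_single,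
      map_add, map_smul, LinearMap.smul_apply, Module.End.one_apply, Submodule.mem_bot,
      Nat.add_sub_cancel]
    rcases k with _ | k <;> rcases l with _ | l <;>
      simp only [Nat.add_sub_cancel, Nat.cast_zero, zero_mul, zero_smul] <;> push_cast <;> module

theorem stringDegree_le_stringTail {m m' : ℕ} {d : ℤ} (hd : m + m' < d) :
    stringDegree K d ≤ stringTail K m m' := by
  refine Finsupp.supported_mono ?_
  rintro ⟨k, l⟩ hx
  have hx' : (k + l : ℤ) = d := hx
  change m < k ∨ m' < l
  omega

theorem exists_stringRaise_pow_sub_mem [CharZero K] {m m' k l n : ℕ}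
    (h : 2 * (k + l) = m + m' + n) :
    ∃ u ∈ stringDegree K (k + l - n),
      (stringRaise K ^ n) u - Finsupp.single (k, l) 1 ∈ stringTail K m m' := by
  have hkl : Finsupp.single (k, l) (1 : K) ∈ stringDegree K (k + l) :=
    Finsupp.single_mem_supported K _ rfl
  have hS := isLoweringRaising_string K m m'
  refine hS.exists_raise_pow_sub_mem (by omega) (m + m' + 1) hkl ?_
  refine stringDegree_le_stringTail K ?_
    (Module.End.pow_apply_mem_shift hS.raise_degree (m + m' + 1) hkl)
  push_cast
  omega

end Strings

section Lefschetz

variable {K V W : Type} [Field K] [AddCommGroup V] [Module K V] [AddCommGroup W] [Module K W]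

/-- A version of `IsSLEndo` for the degrees `a, …, a + c`, bundling that `f` has degree one. -/
structure IsLefschetz (ℳ : ℤ → Submodule K V) (a : ℤ) (c : ℕ) (f : Module.End K V) : Prop where
  degree : ∀ i, ∀ v ∈ ℳ i, f v ∈ ℳ (i + 1)
  eq_bot : ∀ i, i < a ∨ a + c < i → ℳ i = ⊥
  injective : ∀ j : ℕ, 2 * j ≤ c → ∀ v ∈ ℳ (a + j), (f ^ (c - 2 * j)) v = 0 → v = 0
  surjective : ∀ j : ℕ, 2 * j ≤ c → ∀ w ∈ ℳ (a + c - j), ∃ v ∈ ℳ (a + j), (f ^ (c - 2 * j)) v = w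

/-- The vectors `f ^ k p` of degree `i`, for `p` primitive. -/
def primitiveStrings (ℳ : ℤ → Submodule K V) (a : ℤ) (c : ℕ) (f : Module.End K V) (i : ℤ) :
    Set V :=
  {x | ∃ j k : ℕ, 2 * j ≤ c ∧ a + j + k = i ∧
    ∃ p ∈ ℳ (a + j), (f ^ (c - 2 * j + 1)) p = 0 ∧ (f ^ k) p = x}

namespace IsLefschetz

variable {ℳ : ℤ → Submodule K V} {a : ℤ} {c : ℕ} {f : Module.End K V}

theorem pow_mem (h : IsLefschetz ℳ a c f) (r : ℕ) {i : ℤ} {v : V} (hv : v ∈ ℳ i) :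
    (f ^ r) v ∈ ℳ (i + r) := by
  simpa using Module.End.pow_apply_mem_shift h.degree r hv

theorem pow_mem_span_primitiveStrings (r : ℕ) {i : ℤ} {v : V}
    (hv : v ∈ Submodule.span K (primitiveStrings ℳ a c f i)) :
    (f ^ r) v ∈ Submodule.span K (primitiveStrings ℳ a c f (i + r)) := by
  have : Submodule.span K (primitiveStrings ℳ a c f i) ≤
      (Submodule.span K (primitiveStrings ℳ a c f (i + r))).comap (f ^ r) := by
    rw [Submodule.span_le]
    rintro _ ⟨j, k, hj, hi, p, hp, hp0, rfl⟩
    refine Submodule.subset_span ⟨j, r + k, hj, by push_cast; omega, p, hp, hp0, ?_⟩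
    rw [pow_add, Module.End.mul_apply]
  exact this hv

theorem mem_span_primitiveStrings_of_two_mul_le (h : IsLefschetz ℳ a c f) (j : ℕ)
    (hj : 2 * j ≤ c) {v : V} (hv : v ∈ ℳ (a + j)) :
    v ∈ Submodule.span K (primitiveStrings ℳ a c f (a + j)) := by
  induction j generalizing v with
  | zero =>
    refine Submodule.subset_span ⟨0, 0, hj, by simp, v, hv, ?_, by simp⟩
    have h1 := h.pow_mem (c - 2 * 0 + 1) hv
    rwa [h.eq_bot _ (Or.inr (by push_cast; omega)), Submodule.mem_bot] at h1
  | succ j ih =>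
    have h1 := h.pow_mem (c - 2 * (j + 1) + 1) hv
    rw [show a + (j + 1 : ℕ) + (c - 2 * (j + 1) + 1 : ℕ) = a + c - j by omega] at h1
    obtain ⟨u, hu, hu'⟩ := h.surjective j (by omega) _ h1
    have hfu : f u ∈ ℳ (a + (j + 1 : ℕ)) := by
      convert h.degree _ _ hu using 2
      push_cast
      ring
    have hp : v - f u ∈ Submodule.span K (primitiveStrings ℳ a c f (a + (j + 1 : ℕ))) := by
      refine Submodule.subset_span
        ⟨j + 1, 0, hj, by simp, v - f u, Submodule.sub_mem _ hv hfu, ?_, by simp⟩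
      rw [map_sub, ← hu', ← Module.End.mul_apply (f ^ _) f, ← pow_succ, sub_eq_zero]
      congr 2
      omega
    have hf := pow_mem_span_primitiveStrings 1 (ih (by omega) hu)
    rw [pow_one, add_assoc, ← Nat.cast_add] at hf
    simpa using Submodule.add_mem _ hp hf

theorem le_span_primitiveStrings (h : IsLefschetz ℳ a c f) (i : ℤ) :
    ℳ i ≤ Submodule.span K (primitiveStrings ℳ a c f i) := by
  intro v hv
  by_cases hi : i < a ∨ a + c < i
  · rw [h.eq_bot i hi, Submodule.mem_bot] at hv
    simp [hv]
  push Not at hi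
  by_cases hc : 2 * (i - a) ≤ c
  · obtain ⟨j, rfl⟩ : ∃ j : ℕ, i = a + j := ⟨(i - a).toNat, by omega⟩
    exact h.mem_span_primitiveStrings_of_two_mul_le j (by omega) hv
  · obtain ⟨j, rfl⟩ : ∃ j : ℕ, i = a + c - j := ⟨(a + c - i).toNat, by omega⟩
    obtain ⟨u, hu, rfl⟩ := h.surjective j (by omega) v hv
    have := pow_mem_span_primitiveStrings (c - 2 * j)
      (h.mem_span_primitiveStrings_of_two_mul_le j (by omega) hu)
    rwa [show a + (j : ℤ) + (c - 2 * j : ℕ) = a + c - j by omega] at this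

theorem exists_linearMap_onto_reflection (h : IsLefschetz ℳ a c f) (i : ℤ) :
    ∃ φ : ℳ i →ₗ[K] V, ∀ v ∈ ℳ (2 * a + c - i), ∃ u : ℳ i, φ u = v := by
  by_cases hi : i < a ∨ a + c < i
  · refine ⟨0, fun v hv => ⟨0, ?_⟩⟩
    rw [h.eq_bot _ (by omega), Submodule.mem_bot] at hv
    simp [hv]
  push Not at hi
  by_cases hc : 2 * (i - a) ≤ c
  · obtain ⟨j, rfl⟩ : ∃ j : ℕ, i = a + j := ⟨(i - a).toNat, by omega⟩
    refine ⟨(f ^ (c - 2 * j)).domRestrict _, fun v hv => ?_⟩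
    rw [show 2 * a + c - (a + j) = a + c - (j : ℤ) by ring] at hv
    obtain ⟨u, hu, rfl⟩ := h.surjective j (by omega) v hv
    exact ⟨⟨u, hu⟩, rfl⟩
  · obtain ⟨j, rfl⟩ : ∃ j : ℕ, i = a + c - j := ⟨(a + c - i).toNat, by omega⟩
    obtain ⟨ψ, hψ⟩ := LinearMap.exists_leftInverse_of_injective
      ((f ^ (c - 2 * j)).domRestrict (ℳ (a + j))) (by
        rw [LinearMap.ker_eq_bot']
        rintro ⟨v, hv⟩ hv0
        exact Subtype.ext (h.injective j (by omega) v hv hv0))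
    refine ⟨(ℳ (a + j)).subtype ∘ₗ ψ ∘ₗ (ℳ (a + c - j)).subtype, fun v hv => ?_⟩
    rw [show 2 * a + c - (a + c - j) = a + (j : ℤ) by ring] at hv
    have hfv := h.pow_mem (c - 2 * j) hv
    rw [show a + (j : ℤ) + (c - 2 * j : ℕ) = a + c - j by omega] at hfv
    exact ⟨⟨_, hfv⟩, congrArg Subtype.val (LinearMap.congr_fun hψ ⟨v, hv⟩)⟩

theorem exists_reflection (h : IsLefschetz ℳ a c f) (hM : DirectSum.IsInternal ℳ) :
    ∃ τ : Module.End K V, ∀ i, ∀ v ∈ ℳ i, ∃ u ∈ ℳ (2 * a + c - i), τ u = v := by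
  choose φ hφ using h.exists_linearMap_onto_reflection
  let e := LinearEquiv.ofBijective (DirectSum.coeLinearMap ℳ) hM
  refine ⟨DirectSum.toModule K ℤ V φ ∘ₗ e.symm.toLinearMap, fun i v hv => ?_⟩
  obtain ⟨u, hu⟩ := hφ (2 * a + c - i) v (by rwa [sub_sub_cancel])
  refine ⟨u, u.2, ?_⟩
  have he : e.symm (u : V) = DirectSum.lof K ℤ (fun i => ℳ i) _ u := by
    rw [LinearEquiv.symm_apply_eq]
    exact (DirectSum.coeLinearMap_lof ℳ _ u).symm
  simp [he, hu]

end IsLefschetz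

theorem tmul_mem_tensorGrading {ℳ : ℤ → Submodule K V} {𝒩 : ℤ → Submodule K W} {i j k : ℤ}
    (hk : i + j = k) {v : V} (hv : v ∈ ℳ i) {w : W} (hw : w ∈ 𝒩 j) :
    v ⊗ₜ[K] w ∈ tensorGrading K ℳ 𝒩 k := by
  obtain rfl : j = k - i := by omega
  exact Submodule.mem_iSup_of_mem i ⟨⟨v, hv⟩ ⊗ₜ ⟨w, hw⟩, rfl⟩

theorem tensorGrading_le {ℳ : ℤ → Submodule K V} {𝒩 : ℤ → Submodule K W} {k : ℤ}
    {P : Submodule K (V ⊗[K] W)}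
    (h : ∀ i j, i + j = k → ∀ v ∈ ℳ i, ∀ w ∈ 𝒩 j, v ⊗ₜ[K] w ∈ P) :
    tensorGrading K ℳ 𝒩 k ≤ P := by
  refine iSup_le fun i => ?_
  rintro _ ⟨x, rfl⟩
  induction x using TensorProduct.induction_on with
  | zero => simp
  | tmul v w => exact h i (k - i) (by ring) v v.2 w w.2
  | add x y hx hy => rw [map_add]; exact P.add_mem hx hy

variable {ℳ : ℤ → Submodule K V} {𝒩 : ℤ → Submodule K W} {a a' : ℤ} {c c' : ℕ}
  {f : Module.End K V} {g : Module.End K W}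

/-- The Lefschetz operator `f ⊗ 1 + 1 ⊗ g` on the tensor product. -/
noncomputable abbrev tensorEndo (f : Module.End K V) (g : Module.End K W) :
    Module.End K (V ⊗[K] W) :=
  TensorProduct.map f LinearMap.id + TensorProduct.map LinearMap.id g

theorem linearCombination_stringRaise_pow (p : V) (q : W) (n : ℕ) (u : ℕ × ℕ →₀ K) :
    Finsupp.linearCombination K (fun x : ℕ × ℕ => (f ^ x.1) p ⊗ₜ[K] (g ^ x.2) q)
        ((stringRaise K ^ n) u) =
      (tensorEndo f g ^ n)
        (Finsupp.linearCombination K (fun x : ℕ × ℕ => (f ^ x.1) p ⊗ₜ[K] (g ^ x.2) q) u) := by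
  set π := Finsupp.linearCombination K (fun x : ℕ × ℕ => (f ^ x.1) p ⊗ₜ[K] (g ^ x.2) q) with hπ
  have hcomm : π ∘ₗ stringRaise K = tensorEndo f g ∘ₗ π := by
    refine Finsupp.lhom_ext' fun ⟨k, l⟩ => LinearMap.ext_ring ?_
    simp [stringRaise_single, hπ, pow_succ']
  induction n generalizing u with
  | zero => rfl
  | succ n ih =>
    rw [pow_succ, Module.End.mul_apply, ih, pow_succ, Module.End.mul_apply]
    exact congrArg _ (LinearMap.congr_fun hcomm u)

theorem IsLefschetz.string_tmul_string_mem_map [CharZero K] (hf : IsLefschetz ℳ a c f)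
    (hg : IsLefschetz 𝒩 a' c' g) {j j' k l m m' n : ℕ} {p : V} {q : W} (hp : p ∈ ℳ (a + j))
    (hq : q ∈ 𝒩 (a' + j')) (hp0 : (f ^ (m + 1)) p = 0) (hq0 : (g ^ (m' + 1)) q = 0)
    (hn : 2 * (k + l) = m + m' + n) :
    (f ^ k) p ⊗ₜ[K] (g ^ l) q ∈
      (tensorGrading K ℳ 𝒩 (a + j + (a' + j') + (k + l - n))).map (tensorEndo f g ^ n) := by
  obtain ⟨u, hu, hu'⟩ := exists_stringRaise_pow_sub_mem K hn
  let π := Finsupp.linearCombination K (fun x : ℕ × ℕ => (f ^ x.1) p ⊗ₜ[K] (g ^ x.2) q)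
  refine ⟨π u, ?_, ?_⟩
  · refine Finsupp.apply_mem_of_mem_supported K ?_ hu
    rintro ⟨r, s⟩ hx
    have hx' : (r + s : ℤ) = k + l - n := hx
    simp only [π, Finsupp.linearCombination_single, one_smul]
    exact tmul_mem_tensorGrading (by rw [← hx']; ring) (hf.pow_mem r hp) (hg.pow_mem s hq)
  · have h0 : π ((stringRaise K ^ n) u - Finsupp.single (k, l) 1) ∈ (⊥ : Submodule K _) := by
      refine Finsupp.apply_mem_of_mem_supported K ?_ hu'
      rintro ⟨r, s⟩ hx
      simp only [π, Finsupp.linearCombination_single, one_smul, Submodule.mem_bot]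
      rcases hx with hx | hx
      · rw [Module.End.pow_map_zero_of_le hx hp0, TensorProduct.zero_tmul]
      · rw [Module.End.pow_map_zero_of_le hx hq0, TensorProduct.tmul_zero]
    rw [Submodule.mem_bot, map_sub, sub_eq_zero, linearCombination_stringRaise_pow] at h0
    rw [h0]
    simp [π]

theorem IsLefschetz.tensorGrading_le_map_pow [CharZero K] (hf : IsLefschetz ℳ a c f)
    (hg : IsLefschetz 𝒩 a' c' g) {i : ℕ} (hi : 2 * i ≤ c + c') :
    tensorGrading K ℳ 𝒩 (a + a' + (c + c') - i) ≤
      (tensorGrading K ℳ 𝒩 (a + a' + i)).map (tensorEndo f g ^ (c + c' - 2 * i)) := by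
  refine tensorGrading_le fun s t hst v hv w hw => ?_
  have h2 := Submodule.apply_mem_map₂ (TensorProduct.mk K V W)
    (hf.le_span_primitiveStrings s hv) (hg.le_span_primitiveStrings t hw)
  rw [Submodule.map₂_span_span] at h2
  refine Submodule.span_le.2 ?_ h2
  rintro _ ⟨_, ⟨j, k, hj, hs, p, hp, hp0, rfl⟩, _, ⟨j', l, hj', ht, q, hq, hq0, rfl⟩, rfl⟩
  have := hf.string_tmul_string_mem_map hg (k := k) (l := l) (n := c + c' - 2 * i) hp hq hp0 hq0
    (by omega)
  rwa [show a + j + (a' + j') + (k + l - (c + c' - 2 * i : ℕ)) = a + a' + (i : ℤ) by omega] at this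

theorem IsLefschetz.tensorGrading_pow_injective [CharZero K] [FiniteDimensional K V]
    [FiniteDimensional K W] (hM : DirectSum.IsInternal ℳ) (hN : DirectSum.IsInternal 𝒩)
    (hf : IsLefschetz ℳ a c f) (hg : IsLefschetz 𝒩 a' c' g) {i : ℕ} (hi : 2 * i ≤ c + c')
    {v : V ⊗[K] W} (hv : v ∈ tensorGrading K ℳ 𝒩 (a + a' + i))
    (hv0 : (tensorEndo f g ^ (c + c' - 2 * i)) v = 0) : v = 0 := by
  obtain ⟨τ, hτ⟩ := hf.exists_reflection hM
  obtain ⟨τ', hτ'⟩ := hg.exists_reflection hN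
  set lo := tensorGrading K ℳ 𝒩 (a + a' + i)
  set hi' := tensorGrading K ℳ 𝒩 (a + a' + (c + c') - i)
  have hrefl : lo ≤ hi'.map (TensorProduct.map τ τ') := by
    refine tensorGrading_le fun s t hst x hx y hy => ?_
    obtain ⟨x', hx', rfl⟩ := hτ s x hx
    obtain ⟨y', hy', rfl⟩ := hτ' t y hy
    exact ⟨x' ⊗ₜ y', tmul_mem_tensorGrading (by linarith) hx' hy', rfl⟩
  have h1 := (Submodule.finrank_mono hrefl).trans (Submodule.finrank_map_le _ _)
  have h2 : Module.finrank K hi' ≤ Module.finrank K (lo.map (tensorEndo f g ^ (c + c' - 2 * i))) :=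
    Submodule.finrank_mono (hf.tensorGrading_le_map_pow hg hi)
  set Φ := (tensorEndo f g ^ (c + c' - 2 * i)).domRestrict lo with hΦ
  have h3 := LinearMap.finrank_range_add_finrank_ker Φ
  rw [hΦ, LinearMap.range_domRestrict, ← hΦ] at h3
  have hker : LinearMap.ker Φ = ⊥ := Submodule.finrank_eq_zero.1 (by omega)
  exact congrArg Subtype.val (LinearMap.ker_eq_bot'.1 hker ⟨v, hv⟩ hv0)

end Lefschetz

section LefschetzModules

variable {K A V : Type} [Field K] [CommRing A] [Algebra K A] [AddCommGroup V] [Module K V]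
  [Module A V] [IsScalarTower K A V]

theorem IsSLElem.isLefschetz {𝒜 : ℕ → Submodule K A} {ℳ : ℤ → Submodule K V} {a : ℤ} {c : ℕ}
    {g : A} (hg : IsSLElem K 𝒜 ℳ a (a + c) g) (hM : IsGradedMod K 𝒜 ℳ)
    (hbd : GradedBetween K ℳ a (a + c)) : IsLefschetz ℳ a c (mulMap K V g) where
  degree i v hv := hM.2.1 1 i g hg.1 v hv
  eq_bot := hbd.2.2.2
  injective j hj := by
    have := (hg.2 j (by omega)).1
    rwa [show (a + c - a - 2 * j : ℤ).toNat = c - 2 * j by omega] at this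
  surjective j hj := by
    have := (hg.2 j (by omega)).2
    rwa [show (a + c - a - 2 * j : ℤ).toNat = c - 2 * j by omega] at this

end LefschetzModules

/-- Proposition 3.4 and Lemma 3.5. If `V` (a finite graded
`A`-module) and `W` (a finite graded `B`-module) have the SLP, then `V ⊗_K W`
has the SLP as a graded `A ⊗_K B`-module (a linear form of `A ⊗_K B` is
precisely an element `g ⊗ 1 + 1 ⊗ h` with `g ∈ A₁`, `h ∈ B₁`); moreover, if
`g` is a strong Lefschetz element of `V` and `h` one of `W`, then
`g ⊗ 1 + 1 ⊗ h` is a strong Lefschetz element of `V ⊗_K W`. -/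
theorem statement_2 {K A B V W : Type} [Field K] [CharZero K]
    [CommRing A] [Algebra K A] [CommRing B] [Algebra K B]
    [AddCommGroup V] [Module K V] [Module A V] [IsScalarTower K A V]
    [AddCommGroup W] [Module K W] [Module B W] [IsScalarTower K B W]
    (𝒜 : ℕ → Submodule K A) (ℬ : ℕ → Submodule K B)
    (ℳ : ℤ → Submodule K V) (𝒩 : ℤ → Submodule K W) (a b a' b' : ℤ)
    (hA : IsGradedArtinAlg K 𝒜) (hB : IsGradedArtinAlg K ℬ)
    (hM : IsGradedMod K 𝒜 ℳ) (hN : IsGradedMod K ℬ 𝒩)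
    (hbdV : GradedBetween K ℳ a b) (hbdW : GradedBetween K 𝒩 a' b')
    (hV : ∃ g : A, IsSLElem K 𝒜 ℳ a b g)
    (hW : ∃ h : B, IsSLElem K ℬ 𝒩 a' b' h) :
    (∃ g ∈ 𝒜 1, ∃ h ∈ ℬ 1,
      IsSLEndo K (tensorGrading K ℳ 𝒩) (a + a') (b + b')
        (TensorProduct.map (mulMap K V g) LinearMap.id +
          TensorProduct.map LinearMap.id (mulMap K W h))) ∧
    (∀ g : A, ∀ h : B, IsSLElem K 𝒜 ℳ a b g → IsSLElem K ℬ 𝒩 a' b' h →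
      IsSLEndo K (tensorGrading K ℳ 𝒩) (a + a') (b + b')
        (TensorProduct.map (mulMap K V g) LinearMap.id +
          TensorProduct.map LinearMap.id (mulMap K W h))) := by
  have key : ∀ g : A, ∀ h : B, IsSLElem K 𝒜 ℳ a b g → IsSLElem K ℬ 𝒩 a' b' h →
      IsSLEndo K (tensorGrading K ℳ 𝒩) (a + a') (b + b')
        (TensorProduct.map (mulMap K V g) LinearMap.id +
          TensorProduct.map LinearMap.id (mulMap K W h)) := by
    intro g h hg hh i hi
    obtain ⟨c, rfl⟩ : ∃ c : ℕ, b = a + c := ⟨(b - a).toNat, by have := hbdV.1; omega⟩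
    obtain ⟨c', rfl⟩ : ∃ c' : ℕ, b' = a' + c' := ⟨(b' - a').toNat, by have := hbdW.1; omega⟩
    have hf := hg.isLefschetz hM hbdV
    have hf' := hh.isLefschetz hN hbdW
    have := hM.2.2
    have := hN.2.2
    rw [show (a + c + (a' + c') - (a + a') - 2 * i : ℤ).toNat = c + c' - 2 * i by omega,
      show (a + c + (a' + c') - i : ℤ) = a + a' + (c + c') - i by ring]
    have hi' : 2 * i ≤ c + c' := by omega
    exact ⟨fun v hv hv0 => hf.tensorGrading_pow_injective hM.1 hN.1 hf' hi' hv hv0,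
      fun w hw => hf.tensorGrading_le_map_pow hf' hi' hw⟩
  obtain ⟨g, hg⟩ := hV
  obtain ⟨h, hh⟩ := hW
  exact ⟨⟨g, hg.1, h, hh.1, key g h hg hh⟩, key⟩
end

section
/- Let K be a field of characteristic zero, A and B graded Artinian K-algebras, V a finite graded A-module and W a finite graded B-module. Let z ∈ A_1 and z' ∈ B_1, and suppose the Jordan decomposition of ×z on V is d_1 ⊕ d_2 ⊕ ⋯ ⊕ d_r and that of ×z' on W is f_1 ⊕ f_2 ⊕ ⋯ ⊕ f_{r'}. Then the Jordan decomposition of ×(z ⊗ 1 + 1 ⊗ z') on V ⊗_K W is ⊕_{i,j} ⊕_{k=1}^{min{d_i, f_j}} (d_i + f_j + 1 − 2k). In particular, dim_K (V ⊗_K W)/(z ⊗ 1 + 1 ⊗ z')(V ⊗_K W) = Σ_{i,j} min{d_i, f_j}. -/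
set_option maxHeartbeats 1000000
set_option synthInstance.maxHeartbeats 400000

open TensorProduct

section SlTwo

variable {K U σ : Type} [Field K] [AddCommGroup U] [Module K U]

/-- `X`, `Y`, `H` satisfy the `sl₂` relations (`X` lowering, `Y` raising) and the basis `b`
consists of weight vectors, `b s` having integral weight `w s`. -/
structure IsWeightBasis (X Y H : Module.End K U) (b : Module.Basis σ K U) (w : σ → ℤ) : Prop where
  comm_YX : Y * X - X * Y = H
  comm_HX : H * X - X * H = -(2 : K) • X
  comm_HY : H * Y - Y * H = (2 : K) • Y
  weight : ∀ s, H (b s) = (w s : K) • b s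

namespace IsWeightBasis

variable {X Y H : Module.End K U} {b : Module.Basis σ K U} {w : σ → ℤ}

theorem swap (h : IsWeightBasis X Y H b w) : IsWeightBasis Y X (-H) b (fun s => -w s) where
  comm_YX := by rw [← h.comm_YX]; abel
  comm_HX := by
    have := h.comm_HY
    calc -H * Y - Y * -H = -(H * Y - Y * H) := by noncomm_ring
      _ = _ := by rw [this, neg_smul]
  comm_HY := by
    have := h.comm_HX
    calc -H * X - X * -H = -(H * X - X * H) := by noncomm_ring
      _ = _ := by rw [this, neg_smul, neg_neg]
  weight s := by simp [h.weight]

theorem weight_X (h : IsWeightBasis X Y H b w) {c : K} {v : U} (hv : H v = c • v) :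
    H (X v) = (c - 2) • X v := by
  have := congrArg (fun f : Module.End K U => f v) h.comm_HX
  simp only [LinearMap.sub_apply, Module.End.mul_apply, LinearMap.smul_apply, hv, map_smul] at this
  rw [sub_eq_iff_eq_add.mp this]
  module

theorem weight_Y (h : IsWeightBasis X Y H b w) {c : K} {v : U} (hv : H v = c • v) :
    H (Y v) = (c + 2) • Y v := by
  have := congrArg (fun f : Module.End K U => f v) h.comm_HY
  simp only [LinearMap.sub_apply, Module.End.mul_apply, LinearMap.smul_apply, hv, map_smul] at this
  rw [sub_eq_iff_eq_add.mp this]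
  module

theorem weight_X_pow (h : IsWeightBasis X Y H b w) {c : K} {v : U} (hv : H v = c • v) (k : ℕ) :
    H ((X ^ k) v) = (c - 2 * k) • (X ^ k) v := by
  induction k with
  | zero => simpa using hv
  | succ k ih =>
    rw [pow_succ', Module.End.mul_apply, h.weight_X ih]
    push_cast
    module

theorem weight_Y_pow (h : IsWeightBasis X Y H b w) {c : K} {v : U} (hv : H v = c • v) (k : ℕ) :
    H ((Y ^ k) v) = (c + 2 * k) • (Y ^ k) v := by
  induction k with
  | zero => simpa using hv
  | succ k ih =>
    rw [pow_succ', Module.End.mul_apply, h.weight_Y ih]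
    push_cast
    module

theorem Y_X_apply (h : IsWeightBasis X Y H b w) (v : U) : Y (X v) = X (Y v) + H v := by
  rw [← h.comm_YX]
  simp [Module.End.mul_apply]

theorem Y_X_pow_succ (h : IsWeightBasis X Y H b w) {c : K} {v : U} (hv : H v = c • v) (k : ℕ) :
    Y ((X ^ (k + 1)) v) = (X ^ (k + 1)) (Y v) + ((k + 1) * (c - k)) • (X ^ k) v := by
  induction k with
  | zero => simp [h.Y_X_apply, hv]
  | succ k ih =>
    rw [pow_succ' X (k + 1), Module.End.mul_apply, h.Y_X_apply, ih, h.weight_X_pow hv,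
      map_add, map_smul, pow_succ' X k, Module.End.mul_apply, Module.End.mul_apply,
      Module.End.mul_apply]
    push_cast
    module

theorem repr_eq_zero (h : IsWeightBasis X Y H b w) {c : K} {v : U} (hv : H v = c • v) {s : σ}
    (hs : (w s : K) ≠ c) : b.repr v s = 0 := by
  have key : b.coord s ∘ₗ H = (w s : K) • b.coord s := by
    refine b.ext fun i => ?_
    by_cases hi : i = s
    · simp [h.weight, hi]
    · simp [h.weight, hi]
  have h1 : c * b.repr v s = (w s : K) * b.repr v s := by
    simpa [hv] using LinearMap.congr_fun key v
  have h2 : ((w s : K) - c) * b.repr v s = 0 := by rw [sub_mul, h1, sub_self]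
  exact (mul_eq_zero.mp h2).resolve_left (sub_ne_zero.mpr hs)

theorem eigenspace_eq [CharZero K] (h : IsWeightBasis X Y H b w) (m : ℤ) :
    Module.End.eigenspace H (m : K) = Submodule.span K (b '' {s | w s = m}) := by
  apply le_antisymm
  · intro v hv
    rw [Module.End.mem_eigenspace_iff] at hv
    rw [Module.Basis.mem_span_image]
    intro s hs
    by_contra hne
    exact (Finsupp.mem_support_iff.mp hs) (h.repr_eq_zero hv (by exact_mod_cast hne))
  · rw [Submodule.span_le]
    rintro _ ⟨s, rfl, rfl⟩
    exact Module.End.mem_eigenspace_iff.mpr (h.weight s)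

theorem eq_zero_of_forall_weight_ne (h : IsWeightBasis X Y H b w) {c : K} (hc : ∀ s, (w s : K) ≠ c)
    {v : U} (hv : H v = c • v) : v = 0 :=
  b.ext_elem fun s => by simpa using h.repr_eq_zero hv (hc s)

theorem eq_zero_of_X_pow_eq_zero [CharZero K] (h : IsWeightBasis X Y H b w) (r : ℕ) :
    ∀ (k : ℕ) (m : ℤ) (v : U), (k : ℤ) ≤ m → H v = (m : K) • v → (Y ^ r) v = 0 →
      (X ^ k) v = 0 → v = 0 := by
  induction r with
  | zero => intro k m v _ _ hY _; simpa using hY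
  | succ r ihr =>
    intro k
    induction k with
    | zero => intro m v _ _ _ hX; simpa using hX
    | succ k ihk =>
      intro m v hkm hv hY hX
      have hYv : Y v = 0 := by
        refine ihr (k + 2) (m + 2) (Y v) (by push_cast at hkm ⊢; omega) ?_ ?_ ?_
        · rw [h.weight_Y hv]; push_cast; rfl
        · rw [← Module.End.mul_apply, ← pow_succ]; exact hY
        · have e := h.Y_X_pow_succ hv k
          rw [hX, map_zero] at e
          have e2 := congrArg X e
          rw [map_zero, map_add, map_smul, ← Module.End.mul_apply X, ← Module.End.mul_apply X,
            ← pow_succ', ← pow_succ', hX, smul_zero, add_zero] at e2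
          exact e2.symm
      have e := h.Y_X_pow_succ hv k
      rw [hX, hYv, map_zero, map_zero, zero_add] at e
      refine ihk m v (by push_cast at hkm; omega) hv hY ?_
      refine (smul_eq_zero.mp e.symm).resolve_left (mul_ne_zero ?_ ?_)
      · exact_mod_cast Nat.succ_ne_zero k
      · have : m - k ≠ 0 := by push_cast at hkm; omega
        exact_mod_cast this

variable [Fintype σ]

theorem exists_Y_pow_eq_zero [CharZero K] (h : IsWeightBasis X Y H b w) {m : ℤ} {v : U}
    (hv : H v = (m : K) • v) : ∃ r : ℕ, (Y ^ r) v = 0 := by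
  obtain ⟨N, hN⟩ := (Set.finite_range w).bddAbove
  refine ⟨(N - m).toNat + 1, h.eq_zero_of_forall_weight_ne (fun s hs => ?_) (h.weight_Y_pow hv _)⟩
  have h1 : w s ≤ N := hN ⟨s, rfl⟩
  have h2 : w s = m + 2 * ((N - m).toNat + 1 : ℕ) := by exact_mod_cast hs
  push_cast at h2
  omega

theorem eq_zero_of_X_pow_eq_zero_of_le [CharZero K] (h : IsWeightBasis X Y H b w) {k : ℕ} {m : ℤ} {v : U}
    (hkm : (k : ℤ) ≤ m) (hv : H v = (m : K) • v) (hX : (X ^ k) v = 0) : v = 0 := by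
  obtain ⟨r, hr⟩ := h.exists_Y_pow_eq_zero hv
  exact h.eq_zero_of_X_pow_eq_zero r k m v hkm hv hr hX

/-- The map `X ^ m` from the weight space of weight `m` to that of weight `-m`. -/
noncomputable def powRestrict (h : IsWeightBasis X Y H b w) (m : ℕ) :
    Module.End.eigenspace H ((m : ℤ) : K) →ₗ[K] Module.End.eigenspace H ((-m : ℤ) : K) :=
  (X ^ m).restrict fun v hv => by
    rw [Module.End.mem_eigenspace_iff] at hv ⊢
    rw [h.weight_X_pow hv]
    push_cast
    module

theorem powRestrict_injective [CharZero K] (h : IsWeightBasis X Y H b w) (m : ℕ) :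
    Function.Injective (h.powRestrict m) := by
  rw [← LinearMap.ker_eq_bot, LinearMap.ker_eq_bot']
  intro v hv
  exact Subtype.ext (h.eq_zero_of_X_pow_eq_zero_of_le le_rfl (Module.End.mem_eigenspace_iff.mp v.2)
    (congrArg Subtype.val hv))

theorem finrank_eigenspace_le [CharZero K] [FiniteDimensional K U]
    (h : IsWeightBasis X Y H b w) (m : ℕ) :
    Module.finrank K (Module.End.eigenspace H ((m : ℤ) : K)) ≤
      Module.finrank K (Module.End.eigenspace H ((-m : ℤ) : K)) :=
  LinearMap.finrank_le_finrank_of_injective (h.powRestrict_injective m)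

theorem eigenspace_neg (H : Module.End K U) (c : K) :
    Module.End.eigenspace (-H) c = Module.End.eigenspace H (-c) := by
  ext v
  simp only [Module.End.mem_eigenspace_iff, LinearMap.neg_apply, neg_smul, neg_eq_iff_eq_neg]

theorem powRestrict_surjective [CharZero K] [FiniteDimensional K U]
    (h : IsWeightBasis X Y H b w) (m : ℕ) : Function.Surjective (h.powRestrict m) := by
  refine (LinearMap.injective_iff_surjective_of_finrank_eq_finrank ?_).mp
    (h.powRestrict_injective m)
  refine le_antisymm (h.finrank_eigenspace_le m) ?_
  have := h.swap.finrank_eigenspace_le m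
  rwa [eigenspace_neg, eigenspace_neg, ← Int.cast_neg, ← Int.cast_neg, neg_neg] at this

theorem exists_X_pow_eq [CharZero K] [FiniteDimensional K U] (h : IsWeightBasis X Y H b w)
    {k : ℕ} {m : ℤ} {u : U} (hm : m ≤ -k) (hu : H u = (m : K) • u) :
    ∃ v : U, H v = ((m + 2 * k : ℤ) : K) • v ∧ (X ^ k) v = u := by
  obtain ⟨n, hn⟩ : ∃ n : ℕ, m = -((n + k : ℕ) : ℤ) := ⟨(-m - k).toNat, by push_cast; omega⟩
  subst hn
  obtain ⟨v, hv⟩ := h.powRestrict_surjective (n + k) ⟨u, Module.End.mem_eigenspace_iff.mpr hu⟩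
  refine ⟨(X ^ n) v, ?_, ?_⟩
  · rw [h.weight_X_pow (Module.End.mem_eigenspace_iff.mp v.2)]
    push_cast
    module
  · rw [← Module.End.mul_apply, ← pow_add, add_comm k n]
    exact congrArg Subtype.val hv

theorem ker_X_pow_le [CharZero K] [FiniteDimensional K U] (h : IsWeightBasis X Y H b w) (k : ℕ) :
    LinearMap.ker (X ^ k) ≤ Submodule.span K (b '' {s | w s < k}) := by
  have hinv : ∀ v ∈ LinearMap.ker (X ^ k), H v ∈ LinearMap.ker (X ^ k) := by
    have hc : ∀ n : ℕ, X ^ n * H = (H + (2 * n : K) • 1) * X ^ n := by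
      intro n
      induction n with
      | zero => simp
      | succ n ih =>
        have e : X * H = H * X + (2 : K) • X := by
          rw [← sub_eq_iff_eq_add', ← neg_sub, h.comm_HX, neg_smul, neg_neg]
        rw [pow_succ', mul_assoc, ih, ← mul_assoc, mul_add, e, ← mul_assoc]
        congr 1
        rw [mul_smul_comm, add_mul, smul_mul_assoc, mul_one, one_mul]
        push_cast
        module
    intro v hv
    rw [LinearMap.mem_ker] at hv ⊢
    rw [← Module.End.mul_apply, hc, Module.End.mul_apply, hv, map_zero]
  have htop : ⨆ μ, H.genEigenspace μ 1 = ⊤ := by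
    rw [eq_top_iff, ← b.span_eq, Submodule.span_le]
    rintro _ ⟨s, rfl⟩
    exact Submodule.mem_iSup_of_mem (w s : K) (Module.End.mem_eigenspace_iff.mpr (h.weight s))
  rw [Submodule.eq_iSup_inf_genEigenspace 1 hinv htop]
  refine iSup_le fun μ v hv => ?_
  obtain ⟨hv1, hv2⟩ := hv
  replace hv2 := Module.End.mem_eigenspace_iff.mp hv2
  by_cases hμ : ∃ s, (w s : K) = μ
  · obtain ⟨s, rfl⟩ := hμ
    by_cases hs : w s < k
    · have := (h.eigenspace_eq (w s)).le (Module.End.mem_eigenspace_iff.mpr hv2)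
      refine Submodule.span_mono (Set.image_mono fun t ht => ?_) this
      exact lt_of_eq_of_lt ht hs
    · rw [h.eq_zero_of_X_pow_eq_zero_of_le (not_lt.mp hs) hv2 hv1]
      exact zero_mem _
  · push Not at hμ
    rw [h.eq_zero_of_forall_weight_ne hμ hv2]
    exact zero_mem _

theorem map_X_pow_span [CharZero K] [FiniteDimensional K U] (h : IsWeightBasis X Y H b w)
    (k : ℕ) :
    (Submodule.span K (b '' {s | w s < k})).map (X ^ k) =
      Submodule.span K (b '' {s | w s < -k}) := by
  have weight_mem : ∀ {n m : ℤ} {v : U}, m < n → H v = (m : K) • v →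
      v ∈ Submodule.span K (b '' {s | w s < n}) := by
    intro n m v hmn hv
    refine Submodule.span_mono (Set.image_mono fun t ht => ?_)
      ((h.eigenspace_eq m).le (Module.End.mem_eigenspace_iff.mpr hv))
    exact lt_of_eq_of_lt ht hmn
  apply le_antisymm
  · rw [Submodule.map_span, Submodule.span_le]
    rintro _ ⟨_, ⟨s, hs, rfl⟩, rfl⟩
    refine weight_mem (m := w s - 2 * k) ?_ ?_
    · have : w s < k := hs
      omega
    · rw [h.weight_X_pow (h.weight s)]
      push_cast
      rfl
  · rw [Submodule.span_le]
    rintro _ ⟨s, hs, rfl⟩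
    have hs' : w s < -k := hs
    obtain ⟨v, hv, hvs⟩ := h.exists_X_pow_eq hs'.le (h.weight s)
    exact ⟨v, weight_mem (by omega) hv, hvs⟩

theorem finrank_span_basis_image (b : Module.Basis σ K U) (p : σ → Prop) [DecidablePred p] :
    Module.finrank K (Submodule.span K (b '' {s | p s})) = (Finset.univ.filter p).card := by
  have := finrank_span_eq_card (b.linearIndependent.comp (Subtype.val : {s // p s} → σ)
    Subtype.val_injective)
  rw [Set.range_comp, Subtype.range_coe_subtype] at this
  rw [this, Fintype.card_subtype]

/-- The kernel of `X ^ k` has as many dimensions as there are weights in `[-k, k)`. -/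
theorem finrank_ker_X_pow [CharZero K] (h : IsWeightBasis X Y H b w)
    (k : ℕ) :
    Module.finrank K (LinearMap.ker (X ^ k)) =
      ∑ s, if -(k : ℤ) ≤ w s ∧ w s < k then 1 else 0 := by
  classical
  have : FiniteDimensional K U := b.finiteDimensional_of_finite
  set L := Submodule.span K (b '' {s | w s < k})
  have e := LinearMap.finrank_range_add_finrank_ker ((X ^ k).domRestrict L)
  rw [LinearMap.range_domRestrict, h.map_X_pow_span, LinearMap.ker_domRestrict,
    (Submodule.comapSubtypeEquivOfLe (h.ker_X_pow_le k)).finrank_eq,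
    finrank_span_basis_image, finrank_span_basis_image] at e
  rw [← Finset.card_filter]
  have e2 : (Finset.univ.filter fun s => w s < k).card =
      (Finset.univ.filter fun s => w s < -k).card +
      (Finset.univ.filter fun s => -(k : ℤ) ≤ w s ∧ w s < k).card := by
    rw [← Finset.card_union_of_disjoint]
    · congr 1
      ext s
      simp only [Finset.mem_filter, Finset.mem_univ, true_and, Finset.mem_union]
      omega
    · rw [Finset.disjoint_filter]
      intro s _ _
      omega
  omega

end IsWeightBasis

/-- Weight bases are compatible with tensor products. -/
theorem IsWeightBasis.tensor {U' σ' : Type} [AddCommGroup U'] [Module K U']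
    {X Y H : Module.End K U} {b : Module.Basis σ K U} {w : σ → ℤ}
    {X' Y' H' : Module.End K U'} {b' : Module.Basis σ' K U'} {w' : σ' → ℤ}
    (h : IsWeightBasis X Y H b w) (h' : IsWeightBasis X' Y' H' b' w') :
    IsWeightBasis
      (TensorProduct.map X LinearMap.id + TensorProduct.map LinearMap.id X')
      (TensorProduct.map Y LinearMap.id + TensorProduct.map LinearMap.id Y')
      (TensorProduct.map H LinearMap.id + TensorProduct.map LinearMap.id H')
      (b.tensorProduct b') (fun s => w s.1 + w' s.2) := by
  have comm : ∀ (S T : Module.End K U) (S' T' : Module.End K U'),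
      (TensorProduct.map S LinearMap.id + TensorProduct.map LinearMap.id S') *
        (TensorProduct.map T LinearMap.id + TensorProduct.map LinearMap.id T') -
      (TensorProduct.map T LinearMap.id + TensorProduct.map LinearMap.id T') *
        (TensorProduct.map S LinearMap.id + TensorProduct.map LinearMap.id S') =
      TensorProduct.map (S * T - T * S) LinearMap.id +
        TensorProduct.map LinearMap.id (S' * T' - T' * S') := by
    intro S T S' T'
    ext u u'
    simp only [Module.End.mul_apply, LinearMap.add_apply, LinearMap.sub_apply,
      TensorProduct.AlgebraTensorModule.curry_apply, TensorProduct.curry_apply,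
      LinearMap.restrictScalars_self, TensorProduct.map_tmul, LinearMap.id_apply, map_add,
      TensorProduct.sub_tmul, TensorProduct.tmul_sub]
    abel
  constructor
  · rw [comm, h.comm_YX, h'.comm_YX]
  · rw [comm, h.comm_HX, h'.comm_HX, TensorProduct.map_smul_left, TensorProduct.map_smul_right,
      smul_add]
  · rw [comm, h.comm_HY, h'.comm_HY, TensorProduct.map_smul_left, TensorProduct.map_smul_right,
      smul_add]
  · rintro ⟨s, t⟩
    rw [Module.Basis.tensorProduct_apply, LinearMap.add_apply, TensorProduct.map_tmul,
      TensorProduct.map_tmul, h.weight, h'.weight, LinearMap.id_apply, LinearMap.id_apply,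
      TensorProduct.tmul_smul, ← TensorProduct.smul_tmul', ← add_smul]
    push_cast
    rfl

end SlTwo

section Counting

/-- Exactly `min t k` of the weights `t - 1, t - 3, …, 1 - t` lie in `[-k, k)`. -/
theorem sum_weights_in_window (t k : ℕ) :
    ∑ j ∈ Finset.range t,
      (if -(k : ℤ) ≤ (t : ℤ) - 1 - 2 * j ∧ (t : ℤ) - 1 - 2 * j < k then 1 else 0) = min t k := by
  rw [← Finset.card_filter]
  rcases le_total t k with h | h
  · rw [Finset.filter_true_of_mem, Finset.card_range, min_eq_left h]
    intro j hj
    rw [Finset.mem_range] at hj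
    omega
  · have : (Finset.range t).filter
        (fun j : ℕ => -(k : ℤ) ≤ (t : ℤ) - 1 - 2 * j ∧ (t : ℤ) - 1 - 2 * j < k) =
        Finset.Ico ((t - k + 1) / 2) ((t + k + 1) / 2) := by
      ext j
      simp only [Finset.mem_filter, Finset.mem_range, Finset.mem_Ico]
      omega
    rw [this, Nat.card_Ico, min_eq_right h]
    omega

/-- The Clebsch–Gordan rule at the level of weights. -/
theorem sum_weights_clebschGordan (F : ℤ → ℕ) (d e : ℕ) :
    ∑ a ∈ Finset.range d, ∑ b ∈ Finset.range e,
      F (((d : ℤ) - 1 - 2 * a) + ((e : ℤ) - 1 - 2 * b)) =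
    ∑ i ∈ Finset.range (min d e), ∑ c ∈ Finset.range (d + e - 1 - 2 * i),
      F (((d + e - 1 - 2 * i : ℕ) : ℤ) - 1 - 2 * c) := by
  induction d generalizing e with
  | zero => simp
  | succ d ih =>
    cases e with
    | zero => simp
    | succ e =>
      rw [Nat.add_min_add_right, Finset.sum_range_succ' _ (min d e)]
      have hR : ∑ i ∈ Finset.range (min d e), ∑ c ∈ Finset.range (d + 1 + (e + 1) - 1 - 2 * (i + 1)),
            F (((d + 1 + (e + 1) - 1 - 2 * (i + 1) : ℕ) : ℤ) - 1 - 2 * c) =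
          ∑ a ∈ Finset.range d, ∑ b ∈ Finset.range e,
            F (((d : ℤ) - 1 - 2 * a) + ((e : ℤ) - 1 - 2 * b)) := by
        rw [ih]
        refine Finset.sum_congr rfl fun i _ => ?_
        rw [show d + 1 + (e + 1) - 1 - 2 * (i + 1) = d + e - 1 - 2 * i by omega]
      rw [hR, show d + 1 + (e + 1) - 1 - 2 * 0 = (d + 1) + e by omega,
        Finset.sum_range_add _ (d + 1) e]
      simp_rw [Finset.sum_range_succ' _ e]
      rw [Finset.sum_add_distrib, Finset.sum_range_succ _ d, add_assoc]
      congr 1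
      · refine Finset.sum_congr rfl fun a _ => Finset.sum_congr rfl fun b _ => ?_
        congr 1
        push_cast
        ring
      · rw [add_comm]
        congr 1
        · refine Finset.sum_congr rfl fun a _ => ?_
          congr 1
          push_cast
          ring
        · refine Finset.sum_congr rfl fun a _ => ?_
          congr 1
          push_cast
          ring

/-- A multiset of positive integers is determined by the sums `∑ min n k`. -/
theorem multiset_eq_of_sum_min_eq {s t : Multiset ℕ} (hs : ∀ n ∈ s, 0 < n) (ht : ∀ n ∈ t, 0 < n)
    (h : ∀ k : ℕ, (s.map fun n => min n k).sum = (t.map fun n => min n k).sum) : s = t := by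
  have key : ∀ (u : Multiset ℕ) (k : ℕ),
      (u.map fun n => min n (k + 2)).sum + (u.map fun n => min n k).sum + u.count (k + 1) =
        2 * (u.map fun n => min n (k + 1)).sum := by
    intro u k
    induction u using Multiset.induction_on with
    | empty => simp
    | cons a u ih =>
      simp only [Multiset.map_cons, Multiset.sum_cons, Multiset.count_cons]
      split_ifs <;> omega
  ext n
  cases n with
  | zero =>
    rw [Multiset.count_eq_zero_of_notMem fun h0 => (hs 0 h0).ne rfl,
      Multiset.count_eq_zero_of_notMem fun h0 => (ht 0 h0).ne rfl]
  | succ k =>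
    have h1 := key s k
    have h2 := key t k
    rw [h, h, h] at h1
    omega

end Counting

section JordanBasis

open Polynomial DirectSum

variable {K V : Type} [Field K] [AddCommGroup V] [Module K V]

/-- The basis `1, X, …, X ^ (n - 1)` of `K[X] / (X ^ n)`. -/
theorem exists_basis_quotient_X_pow (K : Type) [Field K] (n : ℕ) :
    ∃ b : Module.Basis (Fin n) K (K[X] ⧸ Submodule.span K[X] {(X : K[X]) ^ n}),
      ∀ j, b j = (X : K[X]) ^ (j : ℕ) • Submodule.Quotient.mk (1 : K[X]) := by
  have hm : ((X : K[X]) ^ n).Monic := monic_X_pow n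
  have hdim : (AdjoinRoot.powerBasis' hm).dim = n := by
    rw [AdjoinRoot.powerBasis'_dim, natDegree_X_pow]
  have hb : ∀ j, (AdjoinRoot.powerBasis' hm).basis.reindex (finCongr hdim) j =
      AdjoinRoot.mk (X ^ n) (X ^ (j : ℕ)) := by
    intro j
    rw [Module.Basis.reindex_apply, PowerBasis.basis_eq_pow, AdjoinRoot.powerBasis'_gen, map_pow]
    rfl
  refine ⟨(AdjoinRoot.powerBasis' hm).basis.reindex (finCongr hdim), fun j => (hb j).trans ?_⟩
  rw [← Submodule.Quotient.mk_smul, smul_eq_mul, mul_one]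
  rfl

/-- A nilpotent endomorphism has a basis consisting of Jordan chains. -/
theorem exists_jordan_basis [FiniteDimensional K V] {f : Module.End K V} (hf : IsNilpotent f) :
    ∃ (r : ℕ) (t : Fin r → ℕ) (b : Module.Basis (Σ i, Fin (t i)) K V) (g : Fin r → V),
      (∀ i j, b ⟨i, j⟩ = (f ^ (j : ℕ)) (g i)) ∧ ∀ i, (f ^ t i) (g i) = 0 := by
  classical
  obtain ⟨N, hN⟩ := hf
  have htors : Module.IsTorsion' (Module.AEval' f) (Submonoid.powers (X : K[X])) := by
    rw [Submodule.isTorsion'_powers_iff]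
    intro v
    obtain ⟨v, rfl⟩ := (Module.AEval'.of f).surjective v
    exact ⟨N, by rw [Module.AEval'.X_pow_smul_of, hN, zero_smul, map_zero]⟩
  obtain ⟨r, t, ⟨e⟩⟩ := Module.torsion_by_prime_power_decomposition (irreducible_X) htors
  choose B hB using fun i => exists_basis_quotient_X_pow K (t i)
  let B₀ : Module.Basis (Σ i, Fin (t i)) K
    (⨁ i, K[X] ⧸ Submodule.span K[X] {(X : K[X]) ^ t i}) := DFinsupp.basis B
  have hB₀ : ∀ i j, B₀ ⟨i, j⟩ = DirectSum.lof K[X] (Fin r)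
      (fun i => K[X] ⧸ Submodule.span K[X] {(X : K[X]) ^ t i}) i (B i j) := by
    intro i j
    apply B₀.repr.injective
    rw [Module.Basis.repr_self]
    ext ⟨i', j'⟩
    change _ = (B i').repr ((DFinsupp.single i (B i j) :
      Π₀ i, K[X] ⧸ Submodule.span K[X] {(X : K[X]) ^ t i}) i') j'
    by_cases h : i = i'
    · subst h
      simp [Finsupp.single_apply]
    · rw [DFinsupp.single_eq_of_ne (Ne.symm h)]
      simp [h]
  let c : Fin r → Module.AEval' f := fun i => e.symm (DirectSum.lof K[X] (Fin r)
      (fun i => K[X] ⧸ Submodule.span K[X] {(X : K[X]) ^ t i}) i (Submodule.Quotient.mk 1))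
  have hpow : ∀ (n : ℕ) (v : Module.AEval' f),
      (Module.AEval'.of f).symm ((X : K[X]) ^ n • v) =
        (f ^ n) ((Module.AEval'.of f).symm v) := by
    intro n v
    obtain ⟨v, rfl⟩ := (Module.AEval'.of f).surjective v
    rw [Module.AEval'.X_pow_smul_of, LinearEquiv.symm_apply_apply, LinearEquiv.symm_apply_apply]
    rfl
  refine ⟨r, t, (B₀.map (e.symm.restrictScalars K)).map (Module.AEval'.of f).symm,
    fun i => (Module.AEval'.of f).symm (c i), fun i j => ?_, fun i => ?_⟩
  · rw [Module.Basis.map_apply, Module.Basis.map_apply, LinearEquiv.restrictScalars_apply, hB₀, hB,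
      map_smul, map_smul, hpow]
  · rw [← hpow, ← map_smul, ← map_smul, ← Submodule.Quotient.mk_smul, smul_eq_mul, mul_one,
      (Submodule.Quotient.mk_eq_zero _).mpr (Submodule.mem_span_singleton_self _), map_zero,
      map_zero, map_zero]

/-- Every nilpotent endomorphism in characteristic zero is the lowering operator of an
`sl₂`-triple, with the weights given by the lengths of its Jordan chains. -/
theorem exists_isWeightBasis [FiniteDimensional K V] {f : Module.End K V}
    (hf : IsNilpotent f) :
    ∃ (r : ℕ) (t : Fin r → ℕ) (b : Module.Basis (Σ i, Fin (t i)) K V) (Y H : Module.End K V),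
      IsWeightBasis f Y H b (fun s => (t s.1 : ℤ) - 1 - 2 * (s.2 : ℕ)) := by
  obtain ⟨r, t, b, g, hb, hg⟩ := exists_jordan_basis hf
  let H : Module.End K V := b.constr K fun s => (((t s.1 : ℤ) - 1 - 2 * (s.2 : ℕ) : ℤ) : K) • b s
  let Y : Module.End K V := b.constr K fun s =>
    (((s.2 : ℕ) : K) * (t s.1 - (s.2 : ℕ))) • (f ^ ((s.2 : ℕ) - 1)) (g s.1)
  have hH : ∀ i n, n ≤ t i →
      H ((f ^ n) (g i)) = ((t i : K) - 1 - 2 * n) • (f ^ n) (g i) := by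
    intro i n hn
    rcases hn.eq_or_lt with rfl | hn
    · rw [hg, map_zero, smul_zero]
    · rw [← hb i ⟨n, hn⟩, Module.Basis.constr_basis]
      push_cast
      rfl
  have hY : ∀ i n, n ≤ t i →
      Y ((f ^ n) (g i)) = ((n : K) * (t i - n)) • (f ^ (n - 1)) (g i) := by
    intro i n hn
    rcases hn.eq_or_lt with rfl | hn
    · rw [hg, map_zero, sub_self, mul_zero, zero_smul]
    · rw [← hb i ⟨n, hn⟩, Module.Basis.constr_basis]
  have hf' : ∀ i n, f ((f ^ n) (g i)) = (f ^ (n + 1)) (g i) := by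
    intro i n
    rw [pow_succ', Module.End.mul_apply]
  refine ⟨r, t, b, Y, H, ?_, ?_, ?_, fun s => b.constr_basis K _ s⟩
  · refine b.ext ?_
    rintro ⟨i, n, hn⟩
    rw [hb, LinearMap.sub_apply, Module.End.mul_apply, Module.End.mul_apply, hf', hY i _ hn,
      hY i _ hn.le, hH i _ hn.le, map_smul, hf', show n.succ - 1 = n from rfl]
    cases n with
    | zero =>
      push_cast
      module
    | succ n =>
      rw [Nat.add_sub_cancel]
      push_cast
      module
  · refine b.ext ?_
    rintro ⟨i, n, hn⟩
    rw [hb, LinearMap.sub_apply, Module.End.mul_apply, Module.End.mul_apply, hf', hH i _ hn,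
      hH i _ hn.le, LinearMap.smul_apply, map_smul, hf']
    push_cast
    module
  · refine b.ext ?_
    rintro ⟨i, n, hn⟩
    rw [hb, LinearMap.sub_apply, Module.End.mul_apply, Module.End.mul_apply, hY i _ hn.le,
      hH i _ hn.le, LinearMap.smul_apply, map_smul, map_smul, hY i _ hn.le,
      hH i _ ((Nat.sub_le n 1).trans hn.le)]
    cases n with
    | zero =>
      push_cast
      module
    | succ n =>
      rw [Nat.add_sub_cancel]
      push_cast
      module

end JordanBasis

section JordanType

variable {K V : Type} [Field K] [AddCommGroup V] [Module K V]

/-- Multiplication by an element of degree one on a bounded graded module is nilpotent. -/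
theorem isNilpotent_mulMap {A : Type} [CommRing A] [Algebra K A] [Module A V]
    [IsScalarTower K A V] {𝒜 : ℕ → Submodule K A} {ℳ : ℤ → Submodule K V} {a b : ℤ}
    (hM : IsGradedMod K 𝒜 ℳ) (hbd : GradedBetween K ℳ a b) {z : A} (hz : z ∈ 𝒜 1) :
    IsNilpotent (mulMap K V z) := by
  have hdeg : ∀ (n : ℕ) (j : ℤ), ∀ v ∈ ℳ j, (mulMap K V z ^ n) v ∈ ℳ (j + n) := by
    intro n j v hv
    induction n with
    | zero => simpa using hv
    | succ n ih =>
      rw [pow_succ', Module.End.mul_apply]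
      have := hM.2.1 1 _ z hz _ ih
      rw [add_assoc] at this
      exact_mod_cast this
  refine ⟨(b - a).toNat + 1, LinearMap.ker_eq_top.mp (eq_top_iff.mpr ?_)⟩
  rw [← hM.1.submodule_iSup_eq_top]
  refine iSup_le fun j v hv => ?_
  rw [LinearMap.mem_ker]
  by_cases hj : j < a
  · rw [hbd.2.2.2 j (Or.inl hj), Submodule.mem_bot] at hv
    rw [hv, map_zero]
  · have := hdeg ((b - a).toNat + 1) j v hv
    rwa [hbd.2.2.2 _ (Or.inr (by push_cast; omega)), Submodule.mem_bot] at this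

theorem sum_map_filter_pos {ι : Type} [Fintype ι] (t : ι → ℕ) (φ : ℕ → ℕ) (hφ : φ 0 = 0) :
    (((Finset.univ.val.map t).filter (0 < ·)).map φ).sum = ∑ i, φ (t i) := by
  have : ∀ s : Multiset ℕ, ((s.filter (0 < ·)).map φ).sum = (s.map φ).sum := by
    intro s
    induction s using Multiset.induction_on with
    | empty => rfl
    | cons n s ih =>
      rcases n.eq_zero_or_pos with rfl | hn
      · simp [ih, hφ]
      · simp [ih, hn]
  rw [this, Multiset.map_map]
  rfl

/-- The Jordan type of the lowering operator of a weight basis made of chains consists of the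
lengths of the nonempty chains. -/
theorem IsJordanType.eq_of_isWeightBasis [CharZero K] {ι : Type} [Fintype ι] {t : ι → ℕ}
    {f Y H : Module.End K V} {b : Module.Basis (Σ i, Fin (t i)) K V}
    (h : IsWeightBasis f Y H b (fun s => (t s.1 : ℤ) - 1 - 2 * (s.2 : ℕ)))
    {d : Multiset ℕ} (hd : IsJordanType K f d) :
    d = (Finset.univ.val.map t).filter (0 < ·) := by
  refine multiset_eq_of_sum_min_eq hd.1 (fun n hn => (Multiset.mem_filter.mp hn).2) fun k => ?_
  rw [← hd.2, h.finrank_ker_X_pow, Fintype.sum_sigma, sum_map_filter_pos _ _ (Nat.zero_min k)]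
  refine Finset.sum_congr rfl fun i _ => ?_
  rw [← sum_weights_in_window, Finset.sum_range]

theorem sum_map_bind_clebschGordan (d e : Multiset ℕ) (φ : ℕ → ℕ) :
    ((d.bind fun di => e.bind fun fj =>
        (Multiset.range (min di fj)).map fun k => di + fj - 1 - 2 * k).map φ).sum =
      (d.map fun di => (e.map fun fj =>
        ∑ k ∈ Finset.range (min di fj), φ (di + fj - 1 - 2 * k)).sum).sum := by
  simp only [Multiset.map_bind, Multiset.sum_bind, Multiset.map_map]
  rfl

/-- The Clebsch–Gordan rule for the Jordan type of `f ⊗ 1 + 1 ⊗ g`. -/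
theorem IsJordanType.tensor [CharZero K] {W : Type} [AddCommGroup W] [Module K W]
    [FiniteDimensional K V] [FiniteDimensional K W]
    {f : Module.End K V} {g : Module.End K W} (hf : IsNilpotent f) (hg : IsNilpotent g)
    {d e : Multiset ℕ} (hd : IsJordanType K f d) (he : IsJordanType K g e) :
    IsJordanType K (TensorProduct.map f LinearMap.id + TensorProduct.map LinearMap.id g)
      (d.bind fun di => e.bind fun fj =>
        (Multiset.range (min di fj)).map fun k => di + fj - 1 - 2 * k) := by
  constructor
  · intro n hn
    simp only [Multiset.mem_bind, Multiset.mem_map, Multiset.mem_range] at hn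
    obtain ⟨p, -, q, -, k, hk, rfl⟩ := hn
    omega
  · intro k
    obtain ⟨r, t, b, Y, H, h⟩ := exists_isWeightBasis hf
    obtain ⟨r', t', b', Y', H', h'⟩ := exists_isWeightBasis hg
    rw [(h.tensor h').finrank_ker_X_pow, sum_map_bind_clebschGordan, hd.eq_of_isWeightBasis h,
      he.eq_of_isWeightBasis h', sum_map_filter_pos t _ (by simp), Fintype.sum_prod_type,
      Fintype.sum_sigma]
    refine Finset.sum_congr rfl fun i _ => ?_
    rw [sum_map_filter_pos t' _ (by simp)]
    simp_rw [Fintype.sum_sigma]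
    rw [Finset.sum_comm]
    refine Finset.sum_congr rfl fun j _ => ?_
    have := sum_weights_clebschGordan
      (fun w => if -(k : ℤ) ≤ w ∧ w < k then 1 else 0) (t i) (t' j)
    simp_rw [sum_weights_in_window, Finset.sum_range (n := t i), Finset.sum_range (n := t' j)]
      at this
    exact this

/-- The number of Jordan blocks is the dimension of the cokernel. -/
theorem IsJordanType.finrank_quotient_range [FiniteDimensional K V] {f : Module.End K V}
    {d : Multiset ℕ} (hd : IsJordanType K f d) :
    Module.finrank K (V ⧸ LinearMap.range f) = d.card := by
  have h1 := (LinearMap.range f).finrank_quotient_add_finrank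
  have h2 := f.finrank_range_add_finrank_ker
  have h3 := hd.2 1
  rw [pow_one, Multiset.map_congr rfl fun n hn => min_eq_right (hd.1 n hn),
    Multiset.map_const', Multiset.sum_replicate, smul_eq_mul, mul_one] at h3
  omega

end JordanType

/-- Lemma 3.8 (1). If the Jordan decomposition of `×z` on `V`
is `d₁ ⊕ ⋯ ⊕ d_r` and that of `×z'` on `W` is `f₁ ⊕ ⋯ ⊕ f_{r'}`, then the
Jordan decomposition of `×(z ⊗ 1 + 1 ⊗ z')` on `V ⊗_K W` is
`⊕_{i,j} ⊕_{k=1}^{min(dᵢ,fⱼ)} (dᵢ + fⱼ + 1 - 2k)`; in particular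
`dim (V⊗W)/(z⊗1+1⊗z')(V⊗W) = Σ_{i,j} min(dᵢ, fⱼ)`. -/
theorem statement_3 {K A B V W : Type} [Field K] [CharZero K]
    [CommRing A] [Algebra K A] [CommRing B] [Algebra K B]
    [AddCommGroup V] [Module K V] [Module A V] [IsScalarTower K A V]
    [AddCommGroup W] [Module K W] [Module B W] [IsScalarTower K B W]
    (𝒜 : ℕ → Submodule K A) (ℬ : ℕ → Submodule K B)
    (ℳ : ℤ → Submodule K V) (𝒩 : ℤ → Submodule K W) (a b a' b' : ℤ)
    (hA : IsGradedArtinAlg K 𝒜) (hB : IsGradedArtinAlg K ℬ)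
    (hM : IsGradedMod K 𝒜 ℳ) (hN : IsGradedMod K ℬ 𝒩)
    (hbdV : GradedBetween K ℳ a b) (hbdW : GradedBetween K 𝒩 a' b')
    (z : A) (hz : z ∈ 𝒜 1) (z' : B) (hz' : z' ∈ ℬ 1)
    (d e : Multiset ℕ)
    (hd : IsJordanType K (mulMap K V z) d) (he : IsJordanType K (mulMap K W z') e) :
    IsJordanType K
      (TensorProduct.map (mulMap K V z) LinearMap.id +
        TensorProduct.map LinearMap.id (mulMap K W z'))
      (d.bind fun di => e.bind fun fj =>
        (Multiset.range (min di fj)).map fun k => di + fj - 1 - 2 * k) ∧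
    Module.finrank K ((V ⊗[K] W) ⧸ LinearMap.range
        (TensorProduct.map (mulMap K V z) LinearMap.id +
          TensorProduct.map LinearMap.id (mulMap K W z'))) =
      (d.bind fun di => e.map fun fj => min di fj).sum := by
  have := hM.2.2
  have := hN.2.2
  have key := IsJordanType.tensor (isNilpotent_mulMap hM hbdV hz)
    (isNilpotent_mulMap hN hbdW hz') hd he
  refine ⟨key, ?_⟩
  rw [key.finrank_quotient_range]
  simp [Multiset.card_bind, Multiset.sum_bind]
end

section
/- Let K be a field of characteristic zero, A a graded Artinian K-algebra, and V = ⊕_{i=a}^{b} V_i a finite graded A-module whose Hilbert function is symmetric and unimodal, with V_a ≠ 0, V_b ≠ 0 and b − a ≥ 1. Let t be a new variable with deg t = 1. Then the following are equivalent: (1) V has the SLP; (2) V ⊗_K K[t]/(t^α) has the WLP as a graded A ⊗_K K[t]-module for every positive integer α; (3) V ⊗_K K[t]/(t^α) has the WLP as a graded A ⊗_K K[t]-module for every α = 1, 2, ..., b−a. -/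
set_option maxHeartbeats 1000000
set_option synthInstance.maxHeartbeats 400000

open TensorProduct

namespace Lefschetz

section Coordinates

variable {K : Type} [Field K]

theorem exists_truncPoly_coord (α : ℕ) :
    ∃ c : ℕ → TruncPoly K α →ₗ[K] K,
      ∀ i < α, ∀ p : Polynomial K, c i (Ideal.Quotient.mk _ p) = p.coeff i := by
  have h : ∀ i : ℕ, ∃ c : TruncPoly K α →ₗ[K] K,
      i < α → ∀ p : Polynomial K, c (Ideal.Quotient.mk _ p) = p.coeff i := by
    intro i
    by_cases hi : i < α
    · refine ⟨((Ideal.span {(Polynomial.X : Polynomial K) ^ α}).restrictScalars K).liftQ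
        (Polynomial.lcoeff K i) ?_, fun _ p => rfl⟩
      intro p hp
      have hp' : (Polynomial.X : Polynomial K) ^ α ∣ p :=
        Ideal.mem_span_singleton.1 hp
      exact Polynomial.X_pow_dvd_iff.1 hp' i hi
    · exact ⟨0, fun h => absurd h hi⟩
  choose c hc using h
  exact ⟨c, hc⟩

/-- The coordinate functional `K[t]/(t^α) → K` reading off the coefficient of `t^i`. -/
noncomputable def truncCoord (α i : ℕ) : TruncPoly K α →ₗ[K] K :=
  (exists_truncPoly_coord (K := K) α).choose i

theorem truncCoord_mk {α i : ℕ} (hi : i < α) (p : Polynomial K) :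
    truncCoord α i (Ideal.Quotient.mk _ p : TruncPoly K α) = p.coeff i :=
  (exists_truncPoly_coord (K := K) α).choose_spec i hi p

theorem tbar_pow (α m : ℕ) :
    tbar K α ^ m = Ideal.Quotient.mk _ ((Polynomial.X : Polynomial K) ^ m) := by
  rw [tbar, map_pow]

theorem truncCoord_tbar_pow {α i : ℕ} (hi : i < α) (m : ℕ) :
    truncCoord α i (tbar K α ^ m) = if i = m then 1 else 0 := by
  rw [tbar_pow, truncCoord_mk hi, Polynomial.coeff_X_pow]

theorem truncCoord_tbar_mul_zero {α : ℕ} (hα : 0 < α) (x : TruncPoly K α) :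
    truncCoord α 0 (tbar K α * x) = 0 := by
  obtain ⟨p, rfl⟩ := Ideal.Quotient.mk_surjective x
  rw [tbar, ← map_mul, truncCoord_mk hα, Polynomial.coeff_X_mul_zero]

theorem truncCoord_tbar_mul_succ {α i : ℕ} (hi : i + 1 < α) (x : TruncPoly K α) :
    truncCoord α (i + 1) (tbar K α * x) = truncCoord α i x := by
  obtain ⟨p, rfl⟩ := Ideal.Quotient.mk_surjective x
  rw [tbar, ← map_mul, truncCoord_mk hi, Polynomial.coeff_X_mul, truncCoord_mk (by omega)]

theorem sum_truncCoord_smul (α : ℕ) (x : TruncPoly K α) :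
    ∑ i ∈ Finset.range α, truncCoord α i x • tbar K α ^ i = x := by
  obtain ⟨p, rfl⟩ := Ideal.Quotient.mk_surjective x
  have h : ∑ i ∈ Finset.range α,
      truncCoord α i (Ideal.Quotient.mk _ p : TruncPoly K α) • tbar K α ^ i =
      Ideal.Quotient.mk _ (∑ i ∈ Finset.range α, p.coeff i • (Polynomial.X : Polynomial K) ^ i) := by
    rw [map_sum]
    refine Finset.sum_congr rfl fun i hi => ?_
    rw [truncCoord_mk (Finset.mem_range.1 hi), tbar_pow]
    rfl
  rw [h, Ideal.Quotient.eq, Ideal.mem_span_singleton, Polynomial.X_pow_dvd_iff]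
  intro d hd
  simp [Polynomial.finsetSum_coeff, Polynomial.coeff_X_pow, hd]

variable {V : Type} [AddCommGroup V] [Module K V]

/-- The `t^i`-coordinate of an element of `V ⊗ K[t]/(t^α)`. -/
noncomputable def tensorCoord (V : Type) [AddCommGroup V] [Module K V] (α i : ℕ) :
    V ⊗[K] TruncPoly K α →ₗ[K] V :=
  (TensorProduct.rid K V).toLinearMap ∘ₗ LinearMap.lTensor V (truncCoord α i)

theorem tensorCoord_tmul (α i : ℕ) (v : V) (x : TruncPoly K α) :
    tensorCoord V α i (v ⊗ₜ[K] x) = truncCoord α i x • v := by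
  simp [tensorCoord]

/-- The element `∑ i < α, y i ⊗ t^i`. -/
noncomputable def ofCoords (K : Type) [Field K] {V : Type} [AddCommGroup V] [Module K V]
    (α : ℕ) (y : ℕ → V) : V ⊗[K] TruncPoly K α :=
  ∑ i ∈ Finset.range α, y i ⊗ₜ[K] (tbar K α ^ i)

theorem tensorCoord_ofCoords {α i : ℕ} (hi : i < α) (y : ℕ → V) :
    tensorCoord V α i (ofCoords K α y) = y i := by
  simp [ofCoords, tensorCoord_tmul, truncCoord_tbar_pow hi, hi]

theorem ofCoords_tensorCoord (α : ℕ) (u : V ⊗[K] TruncPoly K α) :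
    ofCoords K α (fun i => tensorCoord V α i u) = u := by
  induction u with
  | zero => simp [ofCoords]
  | add u w hu hw =>
    conv_rhs => rw [← hu, ← hw]
    simp [ofCoords, TensorProduct.add_tmul, Finset.sum_add_distrib]
  | tmul v x =>
    conv_rhs => rw [← sum_truncCoord_smul α x]
    simp [ofCoords, tensorCoord_tmul, TensorProduct.tmul_sum, TensorProduct.smul_tmul]

theorem ext_tensorCoord {α : ℕ} {u w : V ⊗[K] TruncPoly K α}
    (h : ∀ i < α, tensorCoord V α i u = tensorCoord V α i w) : u = w := by
  rw [← ofCoords_tensorCoord α u, ← ofCoords_tensorCoord α w]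
  refine Finset.sum_congr rfl fun i hi => ?_
  simp only [h i (Finset.mem_range.1 hi)]

theorem tmul_tbar_pow_mem {ℳ : ℤ → Submodule K V} {α i : ℕ} (hi : i < α) {k : ℤ} {v : V}
    (hv : v ∈ ℳ (k - i)) :
    v ⊗ₜ[K] (tbar K α ^ i) ∈ tensorGrading K ℳ (truncGrading K α) k := by
  refine Submodule.mem_iSup_of_mem (k - i) ?_
  have ht : tbar K α ^ i ∈ truncGrading K α (k - (k - i)) := by
    have h : k - (k - i) = (i : ℤ) := by ring
    rw [h, truncGrading, if_pos ⟨by omega, by omega⟩]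
    exact Submodule.mem_span_singleton_self _
  exact ⟨(⟨v, hv⟩ : ℳ (k - i)) ⊗ₜ ⟨_, ht⟩, rfl⟩

theorem mem_tensorGrading_iff {ℳ : ℤ → Submodule K V} {α : ℕ} {k : ℤ}
    {u : V ⊗[K] TruncPoly K α} :
    u ∈ tensorGrading K ℳ (truncGrading K α) k ↔
      ∀ i < α, tensorCoord V α i u ∈ ℳ (k - i) := by
  constructor
  · intro hu i hi
    have hle : tensorGrading K ℳ (truncGrading K α) k ≤
        (ℳ (k - i)).comap (tensorCoord V α i) := by
      refine iSup_le fun l => ?_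
      rintro _ ⟨x, rfl⟩
      induction x with
      | zero => simp
      | add x y hx hy => rw [map_add]; exact Submodule.add_mem _ hx hy
      | tmul v n =>
        obtain ⟨v, hv⟩ := v
        obtain ⟨n, hn⟩ := n
        simp only [TensorProduct.map_tmul, Submodule.subtype_apply, Submodule.mem_comap,
          tensorCoord_tmul]
        rw [truncGrading] at hn
        split_ifs at hn with h
        · obtain ⟨r, rfl⟩ := Submodule.mem_span_singleton.1 hn
          rw [map_smul, truncCoord_tbar_pow hi]
          split_ifs with h'
          · have hl : k - i = l := by omega
            rw [hl]
            exact Submodule.smul_mem _ _ hv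
          · simp
        · rw [Submodule.mem_bot] at hn
          simp [hn]
    exact hle hu
  · intro h
    rw [← ofCoords_tensorCoord α u]
    exact Submodule.sum_mem _ fun i hi =>
      tmul_tbar_pow_mem (Finset.mem_range.1 hi) (h i (Finset.mem_range.1 hi))

theorem ofCoords_mem {ℳ : ℤ → Submodule K V} {α : ℕ} {k : ℤ} {y : ℕ → V}
    (hy : ∀ i < α, y i ∈ ℳ (k - i)) :
    ofCoords K α y ∈ tensorGrading K ℳ (truncGrading K α) k :=
  Submodule.sum_mem _ fun i hi =>
    tmul_tbar_pow_mem (Finset.mem_range.1 hi) (hy i (Finset.mem_range.1 hi))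

/-- The operator `f ⊗ 1 + 1 ⊗ λt` on `V ⊗ K[t]/(t^α)`. -/
noncomputable abbrev shiftEndo (α : ℕ) (f : Module.End K V) (lam : K) :
    Module.End K (V ⊗[K] TruncPoly K α) :=
  TensorProduct.map f LinearMap.id +
    TensorProduct.map LinearMap.id (mulMap K (TruncPoly K α) (lam • tbar K α))

theorem tensorCoord_zero_shiftEndo {α : ℕ} (hα : 0 < α) (f : Module.End K V) (lam : K)
    (u : V ⊗[K] TruncPoly K α) :
    tensorCoord V α 0 (shiftEndo α f lam u) = f (tensorCoord V α 0 u) := by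
  induction u with
  | zero => simp
  | add u w hu hw => simp only [map_add, hu, hw]
  | tmul v x =>
    simp [shiftEndo, mulMap, tensorCoord_tmul, truncCoord_tbar_mul_zero hα]

theorem tensorCoord_succ_shiftEndo {α i : ℕ} (hi : i + 1 < α) (f : Module.End K V) (lam : K)
    (u : V ⊗[K] TruncPoly K α) :
    tensorCoord V α (i + 1) (shiftEndo α f lam u) =
      f (tensorCoord V α (i + 1) u) + lam • tensorCoord V α i u := by
  induction u with
  | zero => simp
  | add u w hu hw => simp only [map_add, hu, hw, smul_add]; abel
  | tmul v x =>
    simp [shiftEndo, mulMap, tensorCoord_tmul, truncCoord_tbar_mul_succ hi]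

end Coordinates

section Homogeneous

variable {K V : Type} [Field K] [AddCommGroup V] [Module K V] {ℳ : ℤ → Submodule K V}
  {f : Module.End K V}

theorem pow_apply_mem (hf : ∀ i, ∀ v ∈ ℳ i, f v ∈ ℳ (i + 1)) (s : ℕ) {j : ℤ} {v : V}
    (hv : v ∈ ℳ j) : (f ^ s) v ∈ ℳ (j + s) := by
  induction s with
  | zero => simpa using hv
  | succ s ih =>
    rw [pow_succ', Module.End.mul_apply]
    have h := hf _ _ ih
    rwa [add_assoc] at h

theorem neg_pow_apply (s : ℕ) (v : V) : ((-f) ^ s) v = (-1 : K) ^ s • (f ^ s) v := by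
  have h : -f = (-1 : K) • f := by simp
  rw [h, smul_pow, LinearMap.smul_apply]

variable {α : ℕ} {k j : ℤ}

theorem shiftEndo_injOn (hα : 0 < α) (hk : j + α = k + 1)
    (hinj : ∀ v ∈ ℳ j, (f ^ α) v = 0 → v = 0) :
    ∀ u ∈ tensorGrading K ℳ (truncGrading K α) k, shiftEndo α f 1 u = 0 → u = 0 := by
  intro u hu h0
  have hcoord : ∀ s, s < α → tensorCoord V α (α - 1 - s) u =
      ((-f) ^ s) (tensorCoord V α (α - 1) u) := by
    intro s
    induction s with
    | zero => intro _; simp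
    | succ s ih =>
      intro hs
      have h := tensorCoord_succ_shiftEndo (i := α - 1 - (s + 1)) (by omega) f 1 u
      have e : α - 1 - (s + 1) + 1 = α - 1 - s := by omega
      rw [h0, map_zero, one_smul, e, ih (by omega)] at h
      rw [pow_succ', Module.End.mul_apply, LinearMap.neg_apply]
      exact eq_neg_of_add_eq_zero_right h.symm
  have hz := tensorCoord_zero_shiftEndo hα f 1 u
  have hlast := hcoord (α - 1) (by omega)
  rw [Nat.sub_self] at hlast
  rw [h0, map_zero, hlast, neg_pow_apply, map_smul, ← Module.End.mul_apply, ← pow_succ',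
    Nat.sub_add_cancel hα] at hz
  have hmem := mem_tensorGrading_iff.1 hu (α - 1) (by omega)
  have hv : tensorCoord V α (α - 1) u = 0 := by
    refine hinj _ ?_ ((smul_eq_zero.1 hz.symm).resolve_left (by simp))
    convert hmem using 2
    omega
  refine ext_tensorCoord fun i hi => ?_
  have h := hcoord (α - 1 - i) (by omega)
  rw [hv, map_zero, show α - 1 - (α - 1 - i) = i by omega] at h
  rw [h, map_zero]

theorem pow_injOn_of_shiftEndo_injOn (hf : ∀ i, ∀ v ∈ ℳ i, f v ∈ ℳ (i + 1)) (hα : 0 < α)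
    (hk : j + α = k + 1)
    (hinj : ∀ u ∈ tensorGrading K ℳ (truncGrading K α) k, shiftEndo α f 1 u = 0 → u = 0) :
    ∀ v ∈ ℳ j, (f ^ α) v = 0 → v = 0 := by
  intro v hv h0
  have hu := hinj (ofCoords K α fun i => ((-f) ^ (α - 1 - i)) v) ?_ ?_
  · have h := tensorCoord_ofCoords (K := K) (show α - 1 < α by omega)
      fun i => ((-f) ^ (α - 1 - i)) v
    rw [hu] at h
    simpa using h.symm
  · refine ofCoords_mem fun i hi => ?_
    rw [neg_pow_apply]
    refine Submodule.smul_mem _ _ ?_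
    convert pow_apply_mem hf (α - 1 - i) hv using 2
    omega
  · refine ext_tensorCoord fun i hi => ?_
    rw [map_zero]
    cases i with
    | zero =>
      rw [tensorCoord_zero_shiftEndo hα, tensorCoord_ofCoords hα, neg_pow_apply, map_smul,
        ← Module.End.mul_apply, ← pow_succ', Nat.sub_zero, Nat.sub_add_cancel hα, h0, smul_zero]
    | succ i =>
      rw [tensorCoord_succ_shiftEndo hi, tensorCoord_ofCoords hi, tensorCoord_ofCoords (by omega),
        one_smul, show α - 1 - i = (α - 1 - (i + 1)) + 1 by omega, pow_succ' (-f),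
        Module.End.mul_apply, LinearMap.neg_apply, add_neg_cancel]

theorem shiftEndo_surjOn (hf : ∀ i, ∀ v ∈ ℳ i, f v ∈ ℳ (i + 1)) (hα : 0 < α)
    (hk : j + α = k + 1) (hsurj : ∀ w ∈ ℳ (k + 1), ∃ v ∈ ℳ j, (f ^ α) v = w) :
    ∀ w ∈ tensorGrading K ℳ (truncGrading K α) (k + 1),
      ∃ u ∈ tensorGrading K ℳ (truncGrading K α) k, shiftEndo α f 1 u = w := by
  intro w hw
  let z : ℕ → V := fun s => Nat.rec 0 (fun s y => tensorCoord V α (α - 1 - s) w - f y) s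
  have hz1 : ∀ s, z (s + 1) = tensorCoord V α (α - 1 - s) w - f (z s) := fun s => rfl
  have hzmem : ∀ s, s ≤ α → z s ∈ ℳ (j + s) := by
    intro s
    induction s with
    | zero => intro _; exact Submodule.zero_mem _
    | succ s ih =>
      intro hs
      rw [hz1]
      refine Submodule.sub_mem _ ?_ ?_
      · convert mem_tensorGrading_iff.1 hw (α - 1 - s) (by omega) using 2
        push_cast
        omega
      · convert hf _ _ (ih (by omega)) using 2
        push_cast
        ring
  have hzα : z α ∈ ℳ (k + 1) := hk ▸ hzmem α le_rfl
  obtain ⟨v, hv, hvz⟩ := hsurj (-((-1 : K) ^ α • z α))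
    (Submodule.neg_mem _ (Submodule.smul_mem _ _ hzα))
  have hy1 : ∀ s, ((-f) ^ (s + 1)) v + z (s + 1) =
      tensorCoord V α (α - 1 - s) w - f (((-f) ^ s) v + z s) := by
    intro s
    rw [hz1, pow_succ', Module.End.mul_apply, LinearMap.neg_apply, map_add]
    abel
  have hyα : ((-f) ^ α) v + z α = 0 := by
    rw [neg_pow_apply, hvz, smul_neg, smul_smul, ← mul_pow]
    simp
  refine ⟨ofCoords K α fun i => ((-f) ^ (α - 1 - i)) v + z (α - 1 - i), ?_, ?_⟩
  · refine ofCoords_mem fun i hi => ?_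
    have e : k - i = j + (α - 1 - i : ℕ) := by omega
    rw [neg_pow_apply, e]
    exact Submodule.add_mem _ (Submodule.smul_mem _ _ (pow_apply_mem hf _ hv))
      (hzmem _ (by omega))
  · refine ext_tensorCoord fun i hi => ?_
    cases i with
    | zero =>
      rw [tensorCoord_zero_shiftEndo hα, tensorCoord_ofCoords hα]
      have h := hy1 (α - 1)
      rw [Nat.sub_add_cancel hα, hyα, Nat.sub_self] at h
      exact (sub_eq_zero.1 h.symm).symm
    | succ i =>
      rw [tensorCoord_succ_shiftEndo hi, tensorCoord_ofCoords hi, tensorCoord_ofCoords (by omega),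
        one_smul]
      have h := hy1 (α - 1 - (i + 1))
      rw [show α - 1 - (i + 1) + 1 = α - 1 - i by omega,
        show α - 1 - (α - 1 - (i + 1)) = i + 1 by omega] at h
      rw [h]
      abel

theorem pow_surjOn_of_shiftEndo_surjOn (hα : 0 < α) (hk : j + α = k + 1)
    (hsurj : ∀ w ∈ tensorGrading K ℳ (truncGrading K α) (k + 1),
      ∃ u ∈ tensorGrading K ℳ (truncGrading K α) k, shiftEndo α f 1 u = w) :
    ∀ w ∈ ℳ (k + 1), ∃ v ∈ ℳ j, (f ^ α) v = w := by
  intro w hw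
  obtain ⟨u, hu, huw⟩ := hsurj (w ⊗ₜ[K] (tbar K α ^ 0)) (tmul_tbar_pow_mem hα (by simpa using hw))
  have hcoord : ∀ s, s < α → tensorCoord V α (α - 1 - s) u =
      ((-f) ^ s) (tensorCoord V α (α - 1) u) := by
    intro s
    induction s with
    | zero => intro _; simp
    | succ s ih =>
      intro hs
      have h := tensorCoord_succ_shiftEndo (i := α - 1 - (s + 1)) (by omega) f 1 u
      rw [huw, tensorCoord_tmul, truncCoord_tbar_pow (by omega), if_neg (by omega), zero_smul,
        one_smul, show α - 1 - (s + 1) + 1 = α - 1 - s by omega, ih (by omega)] at h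
      rw [pow_succ', Module.End.mul_apply, LinearMap.neg_apply]
      exact eq_neg_of_add_eq_zero_right h.symm
  have hz := tensorCoord_zero_shiftEndo hα f 1 u
  have hlast := hcoord (α - 1) (by omega)
  rw [Nat.sub_self] at hlast
  rw [huw, tensorCoord_tmul, truncCoord_tbar_pow hα, if_pos rfl, one_smul, hlast, neg_pow_apply,
    map_smul, ← Module.End.mul_apply, ← pow_succ', Nat.sub_add_cancel hα] at hz
  have hmem := mem_tensorGrading_iff.1 hu (α - 1) (by omega)
  refine ⟨(-1 : K) ^ (α - 1) • tensorCoord V α (α - 1) u, Submodule.smul_mem _ _ ?_, ?_⟩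
  · convert hmem using 2
    omega
  · rw [map_smul, hz]

theorem pow_injOn_of_shiftEndo_zero_injOn (hf : ∀ i, ∀ v ∈ ℳ i, f v ∈ ℳ (i + 1))
    (hk : j + α = k + 1)
    (hinj : ∀ u ∈ tensorGrading K ℳ (truncGrading K α) k, shiftEndo α f 0 u = 0 → u = 0) :
    ∀ v ∈ ℳ j, (f ^ α) v = 0 → v = 0 := by
  have hstep : ∀ s < α, ∀ v ∈ ℳ (j + s), f v = 0 → v = 0 := by
    intro s hs v hv h0
    have h := hinj (v ⊗ₜ[K] (tbar K α ^ (α - 1 - s)))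
      (tmul_tbar_pow_mem (by omega) (by convert hv using 2; omega))
      (by simp [shiftEndo, mulMap, h0])
    have h' := congrArg (tensorCoord V α (α - 1 - s)) h
    rw [tensorCoord_tmul, truncCoord_tbar_pow (by omega)] at h'
    simpa using h'
  intro v hv
  have hall : ∀ s ≤ α, (f ^ s) v = 0 → v = 0 := by
    intro s
    induction s with
    | zero => intro _ h; simpa using h
    | succ s ih =>
      intro hs h
      rw [pow_succ', Module.End.mul_apply] at h
      exact ih (by omega) (hstep s (by omega) _ (pow_apply_mem hf s hv) h)
  exact hall α le_rfl

theorem pow_surjOn_of_shiftEndo_zero_surjOn (hk : j + α = k + 1)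
    (hsurj : ∀ w ∈ tensorGrading K ℳ (truncGrading K α) (k + 1),
      ∃ u ∈ tensorGrading K ℳ (truncGrading K α) k, shiftEndo α f 0 u = w) :
    ∀ w ∈ ℳ (k + 1), ∃ v ∈ ℳ j, (f ^ α) v = w := by
  have hstep : ∀ s < α, ∀ w ∈ ℳ (j + (s + 1 : ℕ)), ∃ v ∈ ℳ (j + s), f v = w := by
    intro s hs w hw
    obtain ⟨u, hu, huw⟩ := hsurj (w ⊗ₜ[K] (tbar K α ^ (α - 1 - s)))
      (tmul_tbar_pow_mem (by omega) (by convert hw using 2; omega))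
    refine ⟨tensorCoord V α (α - 1 - s) u, ?_, ?_⟩
    · convert mem_tensorGrading_iff.1 hu (α - 1 - s) (by omega) using 2
      omega
    · have h := congrArg (tensorCoord V α (α - 1 - s)) huw
      rw [tensorCoord_tmul, truncCoord_tbar_pow (by omega), if_pos rfl, one_smul] at h
      rw [← h]
      rcases Nat.eq_zero_or_pos (α - 1 - s) with e | e
      · rw [e, tensorCoord_zero_shiftEndo (by omega)]
      · obtain ⟨i, hi⟩ := Nat.exists_eq_succ_of_ne_zero e.ne'
        rw [hi, tensorCoord_succ_shiftEndo (by omega), zero_smul, add_zero]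
  have hall : ∀ s ≤ α, ∀ w ∈ ℳ (j + s), ∃ v ∈ ℳ j, (f ^ s) v = w := by
    intro s
    induction s with
    | zero => intro _ w hw; exact ⟨w, by simpa using hw, by simp⟩
    | succ s ih =>
      intro hs w hw
      obtain ⟨v, hv, rfl⟩ := hstep s (by omega) w hw
      obtain ⟨x, hx, rfl⟩ := ih (by omega) v hv
      exact ⟨x, hx, by rw [pow_succ', Module.End.mul_apply]⟩
  intro w hw
  exact hall α le_rfl w (hk ▸ hw)

theorem pow_injOn_iff_surjOn [FiniteDimensional K V] (hf : ∀ i, ∀ v ∈ ℳ i, f v ∈ ℳ (i + 1))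
    {n : ℕ} {j' : ℤ} (hj : j + n = j') (hdim : hilb K ℳ j = hilb K ℳ j') :
    (∀ v ∈ ℳ j, (f ^ n) v = 0 → v = 0) ↔ (∀ w ∈ ℳ j', ∃ v ∈ ℳ j, (f ^ n) v = w) := by
  subst hj
  let F : ℳ j →ₗ[K] ℳ (j + n) := (f ^ n).restrict fun v hv => pow_apply_mem hf n hv
  have hF : Function.Injective F ↔ Function.Surjective F :=
    LinearMap.injective_iff_surjective_of_finrank_eq_finrank hdim
  have h1 : Function.Injective F ↔ ∀ v ∈ ℳ j, (f ^ n) v = 0 → v = 0 := by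
    rw [injective_iff_map_eq_zero]
    exact ⟨fun h v hv h0 => congrArg Subtype.val (h ⟨v, hv⟩ (Subtype.ext h0)),
      fun h v h0 => Subtype.ext (h v v.2 (congrArg Subtype.val h0))⟩
  have h2 : Function.Surjective F ↔ ∀ w ∈ ℳ (j + n), ∃ v ∈ ℳ j, (f ^ n) v = w := by
    constructor
    · intro h w hw
      obtain ⟨v, hv⟩ := h ⟨w, hw⟩
      exact ⟨v, v.2, congrArg Subtype.val hv⟩
    · intro h w
      obtain ⟨v, hv, hvw⟩ := h w w.2
      exact ⟨⟨v, hv⟩, Subtype.ext hvw⟩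
  rw [← h1, ← h2, hF]

end Homogeneous

section Generic

variable {K V : Type} [Field K] [AddCommGroup V] [Module K V] [FiniteDimensional K V]

theorem exists_polynomial_eval_eq_det {W : Type} [AddCommGroup W] [Module K W]
    [FiniteDimensional K W] (L : V →ₗ[K] W) (ι : W →ₗ[K] V) (F G : Module.End K V) (n : ℕ) :
    ∃ p : Polynomial K, ∀ x : K,
      p.eval x = LinearMap.det (L ∘ₗ (((1 - x) • F + x • G) ^ n) ∘ₗ ι) := by
  classical
  let bV := Module.finBasis K V
  let bW := Module.finBasis K W
  let MF := LinearMap.toMatrix bV bV F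
  let MG := LinearMap.toMatrix bV bV G
  let C := (Polynomial.C : K →+* Polynomial K)
  refine ⟨((LinearMap.toMatrix bV bW L).map C *
    ((1 - Polynomial.X : Polynomial K) • MF.map C + (Polynomial.X : Polynomial K) • MG.map C) ^ n *
    (LinearMap.toMatrix bW bV ι).map C).det, fun x => ?_⟩
  have hC : ∀ {m l : Type} (M : Matrix m l K), (M.map C).map (Polynomial.evalRingHom x) = M := by
    intro m l M
    ext i j
    simp [C]
  have hsum : ((1 - Polynomial.X : Polynomial K) • MF.map C +
      (Polynomial.X : Polynomial K) • MG.map C).map (Polynomial.evalRingHom x) =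
      (1 - x) • MF + x • MG := by
    ext i j
    simp [C]
    ring
  have hpow : (((1 - Polynomial.X : Polynomial K) • MF.map C +
      (Polynomial.X : Polynomial K) • MG.map C) ^ n).map (Polynomial.evalRingHom x) =
      ((1 - x) • MF + x • MG) ^ n := by
    rw [← hsum]
    exact map_pow (Polynomial.evalRingHom x).mapMatrix _ n
  rw [← Polynomial.coe_evalRingHom, RingHom.map_det, RingHom.mapMatrix_apply, Matrix.map_mul,
    Matrix.map_mul, hC, hC, hpow, ← LinearMap.det_toMatrix bW, LinearMap.toMatrix_comp bW bV bW,
    LinearMap.toMatrix_comp bW bV bV, ← LinearMap.toMatrix_pow, map_add, map_smul, map_smul,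
    Matrix.mul_assoc]

theorem exists_polynomial_eval_ne_zero_iff {ℳ : ℤ → Submodule K V} {F G : Module.End K V}
    (hF : ∀ i, ∀ v ∈ ℳ i, F v ∈ ℳ (i + 1)) (hG : ∀ i, ∀ v ∈ ℳ i, G v ∈ ℳ (i + 1))
    {n : ℕ} {j j' : ℤ} (hj : j + n = j') (hdim : hilb K ℳ j = hilb K ℳ j') :
    ∃ p : Polynomial K, ∀ x : K, p.eval x ≠ 0 ↔
      ∀ v ∈ ℳ j, (((1 - x) • F + x • G) ^ n) v = 0 → v = 0 := by
  obtain ⟨π, hπ⟩ := (ℳ j').subtype.exists_leftInverse_of_injective (ℳ j').ker_subtype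
  let e : ℳ j' ≃ₗ[K] ℳ j := LinearEquiv.ofFinrankEq _ _ hdim.symm
  obtain ⟨p, hp⟩ := exists_polynomial_eval_eq_det (e.toLinearMap ∘ₗ π) (ℳ j).subtype F G n
  refine ⟨p, fun x => ?_⟩
  have hH : ∀ i, ∀ v ∈ ℳ i, ((1 - x) • F + x • G) v ∈ ℳ (i + 1) := fun i v hv =>
    Submodule.add_mem _ (Submodule.smul_mem _ _ (hF i v hv)) (Submodule.smul_mem _ _ (hG i v hv))
  rw [hp, ← isUnit_iff_ne_zero, ← LinearMap.isUnit_iff_isUnit_det, LinearMap.isUnit_iff_ker_eq_bot,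
    LinearMap.ker_eq_bot']
  have key : ∀ v : ℳ j, ((e.toLinearMap ∘ₗ π) ∘ₗ (((1 - x) • F + x • G) ^ n) ∘ₗ (ℳ j).subtype) v = 0
      ↔ (((1 - x) • F + x • G) ^ n) (v : V) = 0 := by
    intro v
    have hmem := hj ▸ pow_apply_mem hH n v.2
    have h := LinearMap.congr_fun hπ ⟨_, hmem⟩
    simp only [LinearMap.comp_apply, Submodule.subtype_apply, LinearEquiv.coe_coe,
      LinearMap.id_apply] at h ⊢
    rw [h, LinearEquiv.map_eq_zero_iff, Submodule.mk_eq_zero]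
  exact ⟨fun h v hv h0 => congrArg Subtype.val (h ⟨v, hv⟩ ((key _).2 h0)),
    fun h v h0 => Subtype.ext (h v v.2 ((key v).1 h0))⟩

end Generic

section Main

variable {K A V : Type} [Field K] [CommRing A] [Algebra K A]
    [AddCommGroup V] [Module K V] [Module A V] [IsScalarTower K A V]
    {𝒜 : ℕ → Submodule K A} {ℳ : ℤ → Submodule K V} {a b : ℤ}

theorem mulMap_mem (hM : IsGradedMod K 𝒜 ℳ) {g : A} (hg : g ∈ 𝒜 1) :
    ∀ i, ∀ v ∈ ℳ i, mulMap K V g v ∈ ℳ (i + 1) := fun i v hv => by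
  exact_mod_cast hM.2.1 1 i g hg v hv

theorem mulMap_smul (c : K) (g : A) : mulMap K V (c • g) = c • mulMap K V g := by
  ext v
  simp [mulMap]

theorem mulMap_add (g h : A) : mulMap K V (g + h) = mulMap K V g + mulMap K V h := by
  ext v
  simp [mulMap]

/-- A homogeneous strong Lefschetz operator has powers of maximal rank in every degree. -/
theorem pow_injOn_or_surjOn {f : Module.End K V} (hf : ∀ i, ∀ v ∈ ℳ i, f v ∈ ℳ (i + 1))
    (hbd : GradedBetween K ℳ a b) (hSL : IsSLEndo K ℳ a b f) (j : ℤ) (α : ℕ) :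
    (∀ v ∈ ℳ j, (f ^ α) v = 0 → v = 0) ∨
      (∀ w ∈ ℳ (j + α), ∃ v ∈ ℳ j, (f ^ α) v = w) := by
  rcases le_total (2 * j + α) (a + b) with h | h
  · left
    intro v hv h0
    rcases lt_or_ge j a with hja | hja
    · simpa [hbd.2.2.2 j (Or.inl hja)] using hv
    · obtain ⟨i, hi⟩ := Int.eq_ofNat_of_zero_le (sub_nonneg.2 hja)
      refine (hSL i (by omega)).1 v (by convert hv using 2; omega) ?_
      obtain ⟨m, hm⟩ := Nat.exists_eq_add_of_le (show α ≤ (b - a - 2 * i).toNat by omega)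
      rw [hm, add_comm, pow_add, Module.End.mul_apply, h0, map_zero]
  · right
    intro w hw
    rcases lt_or_ge b (j + α) with hjb | hjb
    · refine ⟨0, Submodule.zero_mem _, ?_⟩
      rw [hbd.2.2.2 _ (Or.inr hjb), Submodule.mem_bot] at hw
      rw [hw, map_zero]
    · obtain ⟨i, hi⟩ := Int.eq_ofNat_of_zero_le (sub_nonneg.2 hjb)
      obtain ⟨v, hv, hvw⟩ := (hSL i (by omega)).2 w (by convert hw using 2; omega)
      obtain ⟨m, hm⟩ := Nat.exists_eq_add_of_le (show α ≤ (b - a - 2 * i).toNat by omega)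
      rw [hm, pow_add, Module.End.mul_apply] at hvw
      refine ⟨_, ?_, hvw⟩
      convert pow_apply_mem hf m hv using 2
      omega

theorem isWLEndo_of_isSLElem (hM : IsGradedMod K 𝒜 ℳ) (hbd : GradedBetween K ℳ a b) {g : A}
    (hg : IsSLElem K 𝒜 ℳ a b g) {α : ℕ} (hα : 0 < α) :
    IsWLEndo K (tensorGrading K ℳ (truncGrading K α)) a (b + (α : ℤ) - 1)
      (shiftEndo α (mulMap K V g) 1) := by
  intro k _ _
  have hf := mulMap_mem hM hg.1
  have hk : (k + 1 - α) + (α : ℤ) = k + 1 := by ring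
  refine (pow_injOn_or_surjOn hf hbd hg.2 (k + 1 - α) α).imp (shiftEndo_injOn hα hk) fun h => ?_
  rw [hk] at h
  exact shiftEndo_surjOn hf hα hk h

theorem shiftEndo_smul (α : ℕ) {lam : K} (hlam : lam ≠ 0) (g : A) :
    shiftEndo α (mulMap K V g) lam = lam • shiftEndo α (mulMap K V (lam⁻¹ • g)) 1 := by
  rw [shiftEndo, shiftEndo, mulMap_smul, mulMap_smul, mulMap_smul, TensorProduct.map_smul_left,
    TensorProduct.map_smul_right, TensorProduct.map_smul_right, smul_add, smul_smul, smul_smul,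
    mul_inv_cancel₀ hlam, one_smul, mul_one]

/-- The weak Lefschetz condition in the middle degree of `V ⊗ K[t]/(t^α)` gives a linear form
whose `α`-th power is injective or surjective between the complementary degrees of `V`. -/
theorem exists_pow_injOn_or_surjOn (hM : IsGradedMod K 𝒜 ℳ) {α : ℕ} (hα : 0 < α) {j k : ℤ}
    (hk : j + α = k + 1) {g : A} (hg : g ∈ 𝒜 1) (lam : K)
    (h : (∀ u ∈ tensorGrading K ℳ (truncGrading K α) k,
        shiftEndo α (mulMap K V g) lam u = 0 → u = 0) ∨
      (∀ w ∈ tensorGrading K ℳ (truncGrading K α) (k + 1),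
        ∃ u ∈ tensorGrading K ℳ (truncGrading K α) k, shiftEndo α (mulMap K V g) lam u = w)) :
    ∃ g' ∈ 𝒜 1, (∀ v ∈ ℳ j, (mulMap K V g' ^ α) v = 0 → v = 0) ∨
      (∀ w ∈ ℳ (k + 1), ∃ v ∈ ℳ j, (mulMap K V g' ^ α) v = w) := by
  rcases eq_or_ne lam 0 with rfl | hlam
  · exact ⟨g, hg, h.imp (pow_injOn_of_shiftEndo_zero_injOn (mulMap_mem hM hg) hk)
      (pow_surjOn_of_shiftEndo_zero_surjOn hk)⟩
  · have hg' : lam⁻¹ • g ∈ 𝒜 1 := Submodule.smul_mem _ _ hg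
    rw [shiftEndo_smul α hlam] at h
    refine ⟨lam⁻¹ • g, hg', h.imp (fun h => ?_) (fun h => ?_)⟩
    · refine pow_injOn_of_shiftEndo_injOn (mulMap_mem hM hg') hα hk fun u hu h0 => h u hu ?_
      rw [LinearMap.smul_apply, h0, smul_zero]
    · refine pow_surjOn_of_shiftEndo_surjOn hα hk fun w hw => ?_
      obtain ⟨u, hu, huw⟩ := h w hw
      exact ⟨lam • u, Submodule.smul_mem _ _ hu, by rw [map_smul, ← huw, LinearMap.smul_apply]⟩

/-- Over an infinite field, linear forms that are strong Lefschetz in each single degree can be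
replaced by one common strong Lefschetz element. -/
theorem exists_isSLElem [Infinite K] (hM : IsGradedMod K 𝒜 ℳ) (hsym : SymHilb K ℳ a b)
    (h : ∀ i : ℕ, 2 * (i : ℤ) ≤ b - a → ∃ g ∈ 𝒜 1,
      ∀ v ∈ ℳ (a + i), (mulMap K V g ^ (b - a - 2 * i).toNat) v = 0 → v = 0) :
    ∃ g : A, IsSLElem K 𝒜 ℳ a b g := by
  have : FiniteDimensional K V := hM.2.2
  have hcommon : ∀ N : ℕ, ∃ g ∈ 𝒜 1, ∀ i < N, 2 * (i : ℤ) ≤ b - a →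
      ∀ v ∈ ℳ (a + i), (mulMap K V g ^ (b - a - 2 * i).toNat) v = 0 → v = 0 := by
    intro N
    induction N with
    | zero => exact ⟨0, Submodule.zero_mem _, fun i hi => absurd hi (Nat.not_lt_zero i)⟩
    | succ N ih =>
      obtain ⟨g, hg, hgN⟩ := ih
      by_cases hN : 2 * (N : ℤ) ≤ b - a
      · obtain ⟨g', hg', hN'⟩ := h N hN
        have hpoly : ∀ i : ℕ, ∃ p : Polynomial K, 2 * (i : ℤ) ≤ b - a → ∀ x : K, p.eval x ≠ 0 ↔
            ∀ v ∈ ℳ (a + i), (((1 - x) • mulMap K V g + x • mulMap K V g') ^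
              (b - a - 2 * i).toNat) v = 0 → v = 0 := by
          intro i
          by_cases hi : 2 * (i : ℤ) ≤ b - a
          · obtain ⟨p, hp⟩ := exists_polynomial_eval_ne_zero_iff (mulMap_mem hM hg)
              (mulMap_mem hM hg') (n := (b - a - 2 * i).toNat) (j := a + i) (j' := b - i)
              (by omega) (hsym i)
            exact ⟨p, fun _ => hp⟩
          · exact ⟨0, fun h => absurd h hi⟩
        choose p hp using hpoly
        have hne : ∏ i ∈ Finset.range (N + 1), p i ≠ 0 := by
          refine Finset.prod_ne_zero_iff.2 fun i hi => ?_
          have hi' : i ≤ N := Nat.lt_succ_iff.1 (Finset.mem_range.1 hi)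
          have hib : 2 * (i : ℤ) ≤ b - a := by omega
          rcases hi'.lt_or_eq with hlt | rfl
          · have hev := (hp i hib 0).2 (by simpa using hgN i hlt hib)
            rintro h0
            simp [h0] at hev
          · have hev := (hp i hib 1).2 (by simpa using hN')
            rintro h0
            simp [h0] at hev
        obtain ⟨x, hx⟩ : ∃ x : K, (∏ i ∈ Finset.range (N + 1), p i).eval x ≠ 0 := by
          by_contra! hall
          exact hne (Polynomial.funext fun x => by simpa using hall x)
        rw [Polynomial.eval_prod, Finset.prod_ne_zero_iff] at hx
        refine ⟨(1 - x) • g + x • g', Submodule.add_mem _ (Submodule.smul_mem _ _ hg)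
          (Submodule.smul_mem _ _ hg'), fun i hi hib => ?_⟩
        rw [mulMap_add, mulMap_smul, mulMap_smul]
        exact (hp i hib x).1 (hx i (Finset.mem_range.2 hi))
      · exact ⟨g, hg, fun i hi hib => hgN i (by omega) hib⟩
  obtain ⟨g, hg, hinj⟩ := hcommon ((b - a).toNat + 1)
  refine ⟨g, hg, fun i hi => ?_⟩
  have hi' := hinj i (by omega) hi
  exact ⟨hi', (pow_injOn_iff_surjOn (mulMap_mem hM hg) (by omega) (hsym i)).1 hi'⟩

theorem exists_isSLElem_of_isWLEndo [Infinite K] (hM : IsGradedMod K 𝒜 ℳ)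
    (hsym : SymHilb K ℳ a b)
    (h : ∀ α : ℕ, 1 ≤ α → (α : ℤ) ≤ b - a → ∃ g ∈ 𝒜 1, ∃ lam : K,
      IsWLEndo K (tensorGrading K ℳ (truncGrading K α)) a (b + (α : ℤ) - 1)
        (shiftEndo α (mulMap K V g) lam)) :
    ∃ g : A, IsSLElem K 𝒜 ℳ a b g := by
  have : FiniteDimensional K V := hM.2.2
  refine exists_isSLElem hM hsym fun i hi => ?_
  rcases Nat.eq_zero_or_pos (b - a - 2 * i).toNat with h0 | hpos
  · refine ⟨0, Submodule.zero_mem _, fun v _ hv => ?_⟩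
    simpa [h0] using hv
  · obtain ⟨g, hg, lam, hWL⟩ := h _ hpos (by omega)
    obtain ⟨g', hg', hor⟩ := exists_pow_injOn_or_surjOn hM hpos (j := a + i) (k := b - i - 1)
      (by omega) hg lam (hWL (b - i - 1) (by omega) (by omega))
    refine ⟨g', hg', hor.elim id fun hs => ?_⟩
    rw [sub_add_cancel] at hs
    exact (pow_injOn_iff_surjOn (mulMap_mem hM hg') (by omega) (hsym i)).2 hs

end Main

end Lefschetz

/-- Proposition 3.9. Let `V` be a finite graded `A`-module
with symmetric unimodal Hilbert function supported on `[a, b]`, `b - a ≥ 1`.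
TFAE: (1) `V` has the SLP; (2) `V ⊗_K K[t]/(t^α)` has the WLP as a graded
`A ⊗_K K[t]`-module for every `α > 0` (a linear form of `A ⊗_K K[t]` is
precisely an element `g ⊗ 1 + 1 ⊗ λt` with `g ∈ A₁`, `λ ∈ K`);
(3) the same for every `α = 1, …, b - a`. -/
theorem statement_4 {K A V : Type} [Field K] [CharZero K]
    [CommRing A] [Algebra K A]
    [AddCommGroup V] [Module K V] [Module A V] [IsScalarTower K A V]
    (𝒜 : ℕ → Submodule K A) (ℳ : ℤ → Submodule K V) (a b : ℤ)
    (hA : IsGradedArtinAlg K 𝒜) (hM : IsGradedMod K 𝒜 ℳ)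
    (hbd : GradedBetween K ℳ a b) (hsym : SymHilb K ℳ a b)
    (huni : UnimodalHilb K ℳ a b) (hab : 1 ≤ b - a) :
    ((∃ g : A, IsSLElem K 𝒜 ℳ a b g) ↔
      (∀ α : ℕ, 0 < α →
        ∃ g ∈ 𝒜 1, ∃ lam : K,
          IsWLEndo K (tensorGrading K ℳ (truncGrading K α)) a (b + (α : ℤ) - 1)
            (TensorProduct.map (mulMap K V g) LinearMap.id +
              TensorProduct.map LinearMap.id
                (mulMap K (TruncPoly K α) (lam • tbar K α))))) ∧
    ((∃ g : A, IsSLElem K 𝒜 ℳ a b g) ↔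
      (∀ α : ℕ, 1 ≤ α → (α : ℤ) ≤ b - a →
        ∃ g ∈ 𝒜 1, ∃ lam : K,
          IsWLEndo K (tensorGrading K ℳ (truncGrading K α)) a (b + (α : ℤ) - 1)
            (TensorProduct.map (mulMap K V g) LinearMap.id +
              TensorProduct.map LinearMap.id
                (mulMap K (TruncPoly K α) (lam • tbar K α))))) := by
  have h12 : (∃ g : A, IsSLElem K 𝒜 ℳ a b g) → ∀ α : ℕ, 0 < α → ∃ g ∈ 𝒜 1, ∃ lam : K,
      IsWLEndo K (tensorGrading K ℳ (truncGrading K α)) a (b + (α : ℤ) - 1)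
        (Lefschetz.shiftEndo α (mulMap K V g) lam) := fun ⟨g, hg⟩ _ hα =>
    ⟨g, hg.1, 1, Lefschetz.isWLEndo_of_isSLElem hM hbd hg hα⟩
  exact ⟨⟨h12, fun h => Lefschetz.exists_isSLElem_of_isWLEndo hM hsym fun α hα _ => h α hα⟩,
    ⟨fun h α hα _ => h12 h α hα, Lefschetz.exists_isSLElem_of_isWLEndo hM hsym⟩⟩
end
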